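/- arXiv:2109.00933 — 7 statements merged into one kernel-verified Lean document; each statement's English description precedes it below -/
import Mathlib

section
/- Let 𝒜 and ℬ be abelian categories with enough projectives and injectives and T : ℬ → 𝒜 a right exact functor. Let Y ∈ ℬ be such that (L_nT)(Y) = 0 for all n ≥ 1. Then for every object (X₁, X₂, φ) of the comma category (T↓𝒜) and every i ≥ 1 there is an isomorphism Ext^i_{(T↓𝒜)}((T(Y), Y, id_{T(Y)}), (X₁, X₂, φ)) ≅ Ext^i_ℬ(Y, X₂). -/
/-!
Formalization of a statement from "Recollements induced by left Frobenius pairs"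
(Ma, Sun, Zhu, Hu). Auxiliary definitions (left Frobenius pairs, the classes
`𝒳̂` and `𝔅^𝒳_𝒴`, etc.) are given first; the statement itself is the final theorem.
-/

noncomputable section
namespace Paper
open CategoryTheory CategoryTheory.Limits ZeroObject

universe w₁ w₂ w₃ v v' u u'

section Core
variable {𝒜 : Type u} [Category.{v} 𝒜] [Abelian 𝒜]

/-- `C` is isomorphic to some member of the class `𝒳`. -/
def MemIso (𝒳 : Set 𝒜) (C : 𝒜) : Prop := ∃ X ∈ 𝒳, Nonempty (X ≅ C)

/-- `C` admits an exact resolution `0 → X_n → ⋯ → X_0 → C → 0` with all `X_i ∈ 𝒳`. -/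
def HasResolutionOfLength (𝒳 : Set 𝒜) : ℕ → 𝒜 → Prop
  | 0, C => MemIso 𝒳 C
  | (n+1), C => ∃ S : ShortComplex 𝒜, S.ShortExact ∧ S.X₃ = C ∧ S.X₂ ∈ 𝒳 ∧
      HasResolutionOfLength 𝒳 n S.X₁

/-- The class `𝒳̂` of objects admitting a finite exact resolution by objects of `𝒳`. -/
def Hat (𝒳 : Set 𝒜) : Set 𝒜 := {C | ∃ n, HasResolutionOfLength 𝒳 n C}

variable [HasExt.{w₁} 𝒜]

/-- `(𝒳, 𝒲)` is a left Frobenius pair in the abelian category `𝒜`: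
`𝒳` is closed under extensions, kernels of epimorphisms and direct summands,
`𝒲` is closed under direct summands, `𝒲 ⊆ 𝒳 ∩ 𝒳^⊥`, and every `X ∈ 𝒳` admits a
short exact sequence `0 → X → W → X' → 0` with `W ∈ 𝒲`, `X' ∈ 𝒳`. -/
structure IsLeftFrobeniusPair (𝒳 𝒲 : Set 𝒜) : Prop where
  closed_extensions : ∀ S : ShortComplex 𝒜, S.ShortExact → S.X₁ ∈ 𝒳 → S.X₃ ∈ 𝒳 → S.X₂ ∈ 𝒳
  closed_kernels_of_epis : ∀ S : ShortComplex 𝒜, S.ShortExact → S.X₂ ∈ 𝒳 → S.X₃ ∈ 𝒳 → S.X₁ ∈ 𝒳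
  closed_summands_X : ∀ C A B : 𝒜, C ∈ 𝒳 → Nonempty (C ≅ A ⊞ B) → A ∈ 𝒳
  closed_summands_W : ∀ C A B : 𝒜, C ∈ 𝒲 → Nonempty (C ≅ A ⊞ B) → A ∈ 𝒲
  W_subset_X : 𝒲 ⊆ 𝒳
  W_subset_rightPerp : ∀ W ∈ 𝒲, ∀ X ∈ 𝒳, ∀ i : ℕ, 1 ≤ i → Subsingleton (Abelian.Ext X W i)
  cogenerator : ∀ X ∈ 𝒳, ∃ S : ShortComplex 𝒜, S.ShortExact ∧ S.X₁ = X ∧ S.X₂ ∈ 𝒲 ∧ S.X₃ ∈ 𝒳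

/-- `(𝒳, 𝒲)` is a strong left Frobenius pair: a left Frobenius pair such that moreover
`𝒲 ⊆ ^⊥𝒳` and every `X ∈ 𝒳` admits a short exact sequence `0 → X' → W → X → 0`
with `W ∈ 𝒲`, `X' ∈ 𝒳`. -/
structure IsStrongLeftFrobeniusPair (𝒳 𝒲 : Set 𝒜) extends IsLeftFrobeniusPair 𝒳 𝒲 : Prop where
  W_subset_leftPerp : ∀ W ∈ 𝒲, ∀ X ∈ 𝒳, ∀ i : ℕ, 1 ≤ i → Subsingleton (Abelian.Ext W X i)
  generator : ∀ X ∈ 𝒳, ∃ S : ShortComplex 𝒜, S.ShortExact ∧ S.X₃ = X ∧ S.X₂ ∈ 𝒲 ∧ S.X₁ ∈ 𝒳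

end Core

section CommaDefs
variable {𝒜 : Type u} [Category.{v} 𝒜] [Abelian 𝒜]
  {ℬ : Type u'} [Category.{v'} ℬ] [Abelian ℬ] (T : ℬ ⥤ 𝒜)

/-- The class `𝔅^𝒳_𝒴` in the comma category `(T ↓ 𝒜)`, consisting of the objects
`(X, Y, φ : T Y ⟶ X)` with `Y ∈ 𝒴`, `φ` a monomorphism and `Coker φ ∈ 𝒳`. -/
def CommaClass (𝒳 : Set 𝒜) (𝒴 : Set ℬ) : Set (Comma T (𝟭 𝒜)) :=
  {Z | Z.left ∈ 𝒴 ∧ Mono Z.hom ∧ MemIso 𝒳 (cokernel Z.hom)}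

end CommaDefs

end Paper

open CategoryTheory CategoryTheory.Limits ZeroObject Paper

universe w₁ w₂ w₃ v v' u u'

namespace CategoryTheory.ProjectiveResolution

section Ext

variable {C : Type u} [Category.{v} C] [Abelian C] [HasExt.{w₁} C] {X : C}
  (R : ProjectiveResolution X)

/-- The cocycles of degree `n` in the complex of morphisms from a projective resolution
to an object. -/
def extCocycles (Y : C) (n : ℕ) : AddSubgroup (R.complex.X n ⟶ Y) where
  carrier := {f | R.complex.d (n + 1) n ≫ f = 0}
  add_mem' {f g} hf hg := by
    rw [Set.mem_ofPred_eq] at hf hg ⊢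
    rw [Preadditive.comp_add, hf, hg, add_zero]
  zero_mem' := comp_zero
  neg_mem' {f} hf := by
    rw [Set.mem_ofPred_eq] at hf ⊢
    rw [Preadditive.comp_neg, hf, neg_zero]

/-- The additive map sending a cocycle to its class in `Ext`. -/
def extMkAddHom (Y : C) (n : ℕ) : R.extCocycles Y n →+ Abelian.Ext.{w₁} X Y n :=
  AddMonoidHom.mk' (fun f ↦ R.extMk f.1 (n + 1) rfl f.2)
    fun f g ↦ (R.add_extMk f.1 g.1 (n + 1) rfl f.2 g.2).symm

lemma extMkAddHom_surjective (Y : C) (n : ℕ) : Function.Surjective (R.extMkAddHom Y n) := by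
  intro α
  obtain ⟨f, hf, rfl⟩ := R.extMk_surjective α (n + 1) rfl
  exact ⟨⟨f, hf⟩, rfl⟩

lemma mem_ker_extMkAddHom_iff {Y : C} {n : ℕ} (f : R.extCocycles Y (n + 1)) :
    f ∈ (R.extMkAddHom Y (n + 1)).ker ↔
      ∃ g : R.complex.X n ⟶ Y, R.complex.d (n + 1) n ≫ g = f.1 :=
  R.extMk_eq_zero_iff f.1 (n + 2) rfl f.2 n rfl

variable {D : Type u'} [Category.{v'} D] [Abelian D] [HasExt.{w₂} D] {X' : D}
  (R' : ProjectiveResolution X')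

/-- Compatible isomorphisms between the groups of morphisms from two projective resolutions
induce isomorphisms between the `Ext`-groups of positive degree. -/
lemma nonempty_ext_addEquiv {Y : C} {Y' : D}
    (e : ∀ n, (R.complex.X n ⟶ Y) ≃+ (R'.complex.X n ⟶ Y'))
    (he : ∀ n (f : R.complex.X n ⟶ Y),
      e (n + 1) (R.complex.d (n + 1) n ≫ f) = R'.complex.d (n + 1) n ≫ e n f) (n : ℕ) :
    Nonempty (Abelian.Ext.{w₁} X Y (n + 1) ≃+ Abelian.Ext.{w₂} X' Y' (n + 1)) := by
  have hcocycles : (R.extCocycles Y (n + 1)).map (e (n + 1)).toAddMonoidHom =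
      R'.extCocycles Y' (n + 1) := by
    ext f
    obtain ⟨f, rfl⟩ := (e (n + 1)).surjective f
    have : R'.complex.d (n + 2) (n + 1) ≫ e (n + 1) f = 0 ↔
        R.complex.d (n + 2) (n + 1) ≫ f = 0 := by
      rw [← he, EmbeddingLike.map_eq_zero_iff]
    refine Iff.trans ?_ this.symm
    exact ⟨fun ⟨g, hg, h⟩ ↦ (e (n + 1)).injective h ▸ hg, fun h ↦ ⟨f, h, rfl⟩⟩
  let z : R.extCocycles Y (n + 1) ≃+ R'.extCocycles Y' (n + 1) :=
    ((e (n + 1)).addSubgroupMap _).trans (AddEquiv.addSubgroupCongr hcocycles)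
  have hz (f) : (z f).1 = e (n + 1) f.1 := rfl
  have hker : (R.extMkAddHom Y (n + 1)).ker.map (z : _ →+ _) =
      (R'.extMkAddHom Y' (n + 1)).ker := by
    ext f
    obtain ⟨f, rfl⟩ := z.surjective f
    have : z f ∈ (R'.extMkAddHom Y' (n + 1)).ker ↔ f ∈ (R.extMkAddHom Y (n + 1)).ker := by
      rw [mem_ker_extMkAddHom_iff, mem_ker_extMkAddHom_iff, (e n).surjective.exists]
      simp_rw [hz, ← he, EmbeddingLike.apply_eq_iff_eq]
    rw [this]
    exact ⟨fun ⟨g, hg, h⟩ ↦ z.injective h ▸ hg, fun h ↦ ⟨f, h, rfl⟩⟩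
  exact ⟨(QuotientAddGroup.quotientKerEquivOfSurjective _
      (R.extMkAddHom_surjective Y (n + 1))).symm.trans
    ((QuotientAddGroup.congr _ _ z hker).trans
      (QuotientAddGroup.quotientKerEquivOfSurjective _ (R'.extMkAddHom_surjective Y' (n + 1))))⟩

end Ext

section Map

variable {C : Type u} [Category.{v} C] [Abelian C] {D : Type u'} [Category.{v'} D] [Abelian D]

lemma map_d_comp_map_π {X : C} (R : ProjectiveResolution X) (F : C ⥤ D)
    [F.PreservesZeroMorphisms] : F.map (R.complex.d 1 0) ≫ F.map (R.π.f 0) = 0 := by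
  rw [← F.map_comp, R.complex_d_comp_π_f_zero, F.map_zero]

/-- A right exact functor preserving projective objects sends a projective resolution whose
image is exact in positive degrees to a projective resolution. -/
def mapOfExact {X : C} (R : ProjectiveResolution X) (F : C ⥤ D) [F.Additive]
    [PreservesFiniteColimits F] [F.PreservesProjectiveObjects]
    (h : ∀ n, ((R.complex.sc (n + 1)).map F).Exact) :
    ProjectiveResolution (F.obj X) where
  complex := (F.mapHomologicalComplex _).obj R.complex
  projective n := Functor.PreservesProjectiveObjects.projective_obj (R.projective n)
  π := (ChainComplex.toSingle₀Equiv _ _).symm ⟨F.map (R.π.f 0), R.map_d_comp_map_π F⟩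
  quasiIso := ⟨fun n => by
    cases n
    · rw [ChainComplex.quasiIsoAt₀_iff, ShortComplex.quasiIso_iff_of_zeros']
      · have hS := ShortComplex.exact_and_epi_g_iff_g_is_cokernel
          (ShortComplex.mk _ _ R.complex_d_comp_π_f_zero) |>.2 ⟨R.isColimitCokernelCofork⟩
        have hπ := ChainComplex.toSingle₀Equiv_symm_apply_f_zero
          (C := (F.mapHomologicalComplex _).obj R.complex) _ (R.map_d_comp_map_π F)
        have := hS.2
        refine (ShortComplex.exact_and_epi_g_iff_of_iso ?_).2
          ⟨hS.1.map_of_epi_of_preservesCokernel F hS.2 inferInstance,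
            inferInstanceAs (Epi (F.map (R.π.f 0)))⟩
        exact ShortComplex.isoMk (Iso.refl _) (Iso.refl _) (Iso.refl _)
          ((Category.id_comp _).trans (Category.comp_id _).symm)
          ((Category.id_comp _).trans (hπ.symm.trans (Category.comp_id _).symm))
      · exact (congrArg F.map (R.complex.shape 0 0 (by simp))).trans (F.map_zero _ _)
      · rfl
      · rfl
    · rw [quasiIsoAt_iff_exactAt']
      · apply h
      · apply ChainComplex.exactAt_succ_single_obj⟩

end Map

end CategoryTheory.ProjectiveResolution

namespace CategoryTheory.Comma

variable {𝒜 : Type u} [Category.{v} 𝒜] {ℬ : Type u'} [Category.{v'} ℬ] (T : ℬ ⥤ 𝒜)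

/-- The functor sending `Y` to `(T Y, Y, 𝟙)`. -/
@[simps]
def idHom : ℬ ⥤ Comma T (𝟭 𝒜) where
  obj Y := ⟨Y, T.obj Y, 𝟙 (T.obj Y)⟩
  map f := { left := f, right := T.map f }

/-- The functor `idHom T` is left adjoint to the first projection. -/
def idHomAdjunction : idHom T ⊣ Comma.fst T (𝟭 𝒜) :=
  Adjunction.mkOfHomEquiv
    { homEquiv Y Z :=
        { toFun f := f.left
          invFun g :=
            { left := g
              right := T.map g ≫ Z.hom
              w := (Category.id_comp _).symm }
          left_inv f := by
            ext
            · rfl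
            · exact f.w.trans (Category.id_comp _)
          right_inv _ := rfl }
      homEquiv_naturality_left_symm f g := by
        ext
        · rfl
        · exact (congrArg (· ≫ _) (T.map_comp f g)).trans (Category.assoc _ _ _) }

section Limits

variable {J : Type*} [Category J] {E : Type*} [Category E] (L : ℬ ⥤ E) (R : 𝒜 ⥤ E)
  [HasLimitsOfShape J 𝒜] [HasLimitsOfShape J ℬ] [PreservesLimitsOfShape J R]

instance preservesLimitsOfShape_fst : PreservesLimitsOfShape J (Comma.fst L R) where
  preservesLimit :=
    preservesLimit_of_preserves_limit_cone
      (coneOfPreservesIsLimit _ (limit.isLimit _) (limit.isLimit _)) (limit.isLimit _)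

instance preservesLimitsOfShape_snd : PreservesLimitsOfShape J (Comma.snd L R) where
  preservesLimit :=
    preservesLimit_of_preserves_limit_cone
      (coneOfPreservesIsLimit _ (limit.isLimit _) (limit.isLimit _)) (limit.isLimit _)

end Limits

variable [Abelian (Comma T (𝟭 𝒜))]

variable {T} in
lemma isZero_of_isZero_left_right {Z : Comma T (𝟭 𝒜)} (hl : IsZero Z.left)
    (hr : IsZero Z.right) : IsZero Z := by
  rw [IsZero.iff_id_eq_zero]
  ext
  · exact hl.eq_of_src _ _
  · exact hr.eq_of_src _ _

variable [Abelian 𝒜] [Abelian ℬ] [PreservesFiniteColimits T]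

instance : PreservesFiniteColimits (Comma.fst T (𝟭 𝒜)) where
  preservesFiniteColimits _ := inferInstance

instance : PreservesFiniteColimits (Comma.snd T (𝟭 𝒜)) where
  preservesFiniteColimits _ := inferInstance

instance : PreservesFiniteLimits (Comma.fst T (𝟭 𝒜)) where
  preservesFiniteLimits _ := inferInstance

instance : PreservesFiniteLimits (Comma.snd T (𝟭 𝒜)) where
  preservesFiniteLimits _ := inferInstance

instance : (Comma.fst T (𝟭 𝒜)).PreservesZeroMorphisms :=
  Functor.preservesZeroMorphisms_of_preserves_terminal_object

instance : (Comma.snd T (𝟭 𝒜)).PreservesZeroMorphisms :=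
  Functor.preservesZeroMorphisms_of_preserves_terminal_object

instance : (Comma.fst T (𝟭 𝒜)).Additive := Functor.additive_of_preserves_binary_products _

instance : (idHom T).Additive := (idHomAdjunction T).left_adjoint_additive

instance : PreservesFiniteColimits (idHom T) :=
  have := (idHomAdjunction T).leftAdjoint_preservesColimits
  inferInstance

instance : (idHom T).PreservesProjectiveObjects where
  projective_obj hP := (idHomAdjunction T).map_projective _ hP

variable {T}

lemma exact_of_exact_fst_snd {S : ShortComplex (Comma T (𝟭 𝒜))}
    (hl : (S.map (Comma.fst T (𝟭 𝒜))).Exact) (hr : (S.map (Comma.snd T (𝟭 𝒜))).Exact) :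
    S.Exact := by
  rw [ShortComplex.exact_iff_isZero_homology] at hl hr ⊢
  exact isZero_of_isZero_left_right
    (hl.of_iso (S.mapHomologyIso (Comma.fst T (𝟭 𝒜))).symm)
    (hr.of_iso (S.mapHomologyIso (Comma.snd T (𝟭 𝒜))).symm)

lemma exact_map_idHom [T.PreservesZeroMorphisms] {S : ShortComplex ℬ} (hS : S.Exact)
    (hTS : (S.map T).Exact) : (S.map (idHom T)).Exact :=
  exact_of_exact_fst_snd (S := S.map (idHom T)) hS hTS

/-- If `T` preserves the exactness in positive degrees of a projective resolution of `Y`, then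
`idHom T` and the first projection satisfy the `Ext` version of their adjunction. -/
lemma nonempty_ext_idHom_addEquiv [T.PreservesZeroMorphisms] [HasExt.{w₂} ℬ]
    [HasExt.{w₃} (Comma T (𝟭 𝒜))] {Y : ℬ} (R : ProjectiveResolution Y)
    (hR : ∀ n, ((R.complex.sc (n + 1)).map T).Exact) (Z : Comma T (𝟭 𝒜)) (n : ℕ) :
    Nonempty (Abelian.Ext.{w₃} ((idHom T).obj Y) Z (n + 1) ≃+
      Abelian.Ext.{w₂} Y Z.left (n + 1)) :=
  let R' := R.mapOfExact (idHom T) fun k ↦ exact_map_idHom (R.complex_exactAt_succ k) (hR k)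
  R'.nonempty_ext_addEquiv R (fun k ↦ (idHomAdjunction T).homAddEquiv (R.complex.X k) Z)
    (fun k f ↦ (idHomAdjunction T).homEquiv_naturality_left (R.complex.d (k + 1) k) f) n

end CategoryTheory.Comma

/-- Lemma 2.4(1): if `(LₙT)(Y) = 0` for all `n ≥ 1`, then
`Ext^i_{(T↓𝒜)}((T Y, Y, id), (X₁, X₂, φ)) ≅ Ext^i_ℬ(Y, X₂)` for all `i ≥ 1`. -/
theorem statement2
    {𝒜 : Type u} [Category.{v} 𝒜] [Abelian 𝒜] [EnoughProjectives 𝒜] [EnoughInjectives 𝒜]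
    {ℬ : Type u'} [Category.{v'} ℬ] [Abelian ℬ] [EnoughProjectives ℬ] [EnoughInjectives ℬ]
    (T : ℬ ⥤ 𝒜) [T.Additive] [PreservesFiniteColimits T]
    [Abelian (Comma T (𝟭 𝒜))]
    [HasExt.{w₂} ℬ] [HasExt.{w₃} (Comma T (𝟭 𝒜))]
    (Y : ℬ) (hLT : ∀ n : ℕ, 1 ≤ n → IsZero ((T.leftDerived n).obj Y))
    (X₁ : 𝒜) (X₂ : ℬ) (φ : T.obj X₂ ⟶ X₁) (i : ℕ) (hi : 1 ≤ i) :
    Nonempty (Abelian.Ext.{w₃} (⟨Y, T.obj Y, 𝟙 (T.obj Y)⟩ : Comma T (𝟭 𝒜))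
      (⟨X₂, X₁, φ⟩ : Comma T (𝟭 𝒜)) i ≃+ Abelian.Ext.{w₂} Y X₂ i) := by
  obtain ⟨n, rfl⟩ := Nat.exists_eq_add_of_le' hi
  let R := ProjectiveResolution.of Y
  have hR (k : ℕ) : ((T.mapHomologicalComplex _).obj R.complex).ExactAt (k + 1) :=
    (HomologicalComplex.exactAt_iff_isZero_homology _ _).2
      ((hLT (k + 1) k.succ_pos).of_iso (R.isoLeftDerivedObj T (k + 1)).symm)
  exact Comma.nonempty_ext_idHom_addEquiv R hR ⟨X₂, X₁, φ⟩ n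
end
end

section
/- Let 𝒜 and ℬ be abelian categories with enough projectives and injectives and T : ℬ → 𝒜 a right exact functor. Then for every X ∈ 𝒜, every object (N₁, N₂, φ) of the comma category (T↓𝒜), and every i ≥ 1 there is an isomorphism Ext^i_{(T↓𝒜)}((X, 0, 0), (N₁, N₂, φ)) ≅ Ext^i_𝒜(X, N₁), where (X, 0, 0) denotes the object with second component the zero object of ℬ and zero structure map. -/
/-!
Formalization of a statement from "Recollements induced by left Frobenius pairs"
(Ma, Sun, Zhu, Hu). Auxiliary definitions (left Frobenius pairs, the classes
`𝒳̂` and `𝔅^𝒳_𝒴`, etc.) are given first; the statement itself is the final theorem.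
-/

noncomputable section
open CategoryTheory CategoryTheory.Limits ZeroObject Paper

universe w₁ w₂ w₃ v v' u u'

namespace CategoryTheory

open Abelian

section ExtAdjunction

variable {C : Type u} [Category.{v} C] [Abelian C] {D : Type u'} [Category.{v'} D] [Abelian D]
  [HasExt.{w₁} C] [HasExt.{w₃} D] {F : C ⥤ D} {G : D ⥤ C}
  [PreservesFiniteLimits G] [PreservesFiniteColimits G]

/-- The map `Extⁿ(F X, Y) → Extⁿ(X, G Y)` induced by an adjunction `F ⊣ G` with `G` exact. -/
def Adjunction.extAddHom [G.Additive] (adj : F ⊣ G) (X : C) (Y : D) (n : ℕ) :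
    Ext.{w₃} (F.obj X) Y n →+ Ext.{w₁} X (G.obj Y) n :=
  ((Ext.mk₀ (adj.unit.app X)).precomp (G.obj Y) (zero_add n)).comp
    (G.mapExtAddHom (F.obj X) Y n)

lemma Adjunction.extAddHom_apply [G.Additive] (adj : F ⊣ G) {X : C} {Y : D} {n : ℕ}
    (x : Ext.{w₃} (F.obj X) Y n) :
    adj.extAddHom X Y n x =
      (Ext.mk₀ (adj.unit.app X)).comp (x.mapExactFunctor G) (zero_add n) := rfl

lemma Adjunction.extAddHom_zero_bijective [G.Additive] (adj : F ⊣ G) (X : C) (Y : D) :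
    Function.Bijective (adj.extAddHom X Y 0 :
      Ext.{w₃} (F.obj X) Y 0 → Ext.{w₁} X (G.obj Y) 0) := by
  have h : adj.extAddHom X Y 0 ∘ Ext.homEquiv₀.symm =
      Ext.homEquiv₀.symm ∘ adj.homEquiv X Y := by
    ext f
    simp [Adjunction.extAddHom_apply, Ext.homEquiv₀, Ext.mapExactFunctor_mk₀,
      Adjunction.homEquiv_unit]
  rw [← Ext.homEquiv₀.symm.bijective.of_comp_iff, h]
  exact Ext.homEquiv₀.symm.bijective.comp (adj.homEquiv X Y).bijective

lemma Adjunction.extAddHom_mk₀_comp [G.Additive] (adj : F ⊣ G) {X X' : C} {Y : D} {n : ℕ}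
    (f : X ⟶ X') (x : Ext.{w₃} (F.obj X') Y n) :
    adj.extAddHom X Y n ((Ext.mk₀ (F.map f)).comp x (zero_add n)) =
      (Ext.mk₀ f).comp (adj.extAddHom X' Y n x) (zero_add n) := by
  simp only [Adjunction.extAddHom_apply, Ext.mapExactFunctor_comp, Ext.mapExactFunctor_mk₀,
    Ext.mk₀_comp_mk₀_assoc]
  congr 2
  exact (adj.unit.naturality f).symm

lemma Adjunction.extAddHom_extClass_comp [G.Additive] [F.Additive]
    [PreservesFiniteLimits F] [PreservesFiniteColimits F] (adj : F ⊣ G)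
    {S : ShortComplex C} (hS : S.ShortExact) {Y : D} {n m : ℕ} (h : 1 + n = m) (x : Ext.{w₃} (S.map F).X₁ Y n) :
    adj.extAddHom S.X₃ Y m ((hS.map_of_exact F).extClass.comp x h) =
      hS.extClass.comp (adj.extAddHom S.X₁ Y n x) h := by
  let η : S ⟶ (S.map F).map G :=
    { τ₁ := adj.unit.app S.X₁
      τ₂ := adj.unit.app S.X₂
      τ₃ := adj.unit.app S.X₃
      comm₁₂ := (adj.unit.naturality S.f).symm
      comm₂₃ := (adj.unit.naturality S.g).symm }
  have key := ShortComplex.ShortExact.extClass_naturality hS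
    ((hS.map_of_exact F).map_of_exact G) η
  calc
    _ = (Ext.mk₀ η.τ₃).comp (((hS.map_of_exact F).extClass.comp x h).mapExactFunctor G)
        (zero_add m) := rfl
    _ = ((Ext.mk₀ η.τ₃).comp ((hS.map_of_exact F).map_of_exact G).extClass (zero_add 1)).comp
        (x.mapExactFunctor G) h := by
      rw [Ext.mapExactFunctor_comp, Ext.mapExactFunctor_extClass]
      exact (Ext.comp_assoc _ _ _ (zero_add 1) h (by lia)).symm
    _ = (hS.extClass.comp (Ext.mk₀ η.τ₁) (add_zero 1)).comp (x.mapExactFunctor G) h := by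
      rw [key]
    _ = hS.extClass.comp ((Ext.mk₀ η.τ₁).comp (x.mapExactFunctor G) (zero_add n)) h :=
      Ext.comp_assoc _ _ _ _ _ (by lia)

lemma Adjunction.extAddHom_bijective [G.Additive] [F.Additive] [PreservesFiniteLimits F]
    [EnoughProjectives C] (adj : F ⊣ G) (X : C) (Y : D) (n : ℕ) :
    Function.Bijective (adj.extAddHom X Y n :
      Ext.{w₃} (F.obj X) Y n → Ext.{w₁} X (G.obj Y) n) := by
  have : PreservesFiniteColimits F := ⟨fun _ _ _ ↦ adj.leftAdjoint_preservesColimits.1⟩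
  induction n generalizing X with
  | zero => exact adj.extAddHom_zero_bijective X Y
  | succ n hn =>
    let P : ProjectivePresentation X := Classical.arbitrary _
    let S := ShortComplex.mk _ _ (kernel.condition P.f)
    have hS : S.ShortExact := { exact := ShortComplex.exact_kernel P.f }
    have : Projective S.X₂ := P.projective
    have : Projective (S.map F).X₂ := adj.map_projective _ P.projective
    have := Ext.subsingleton_of_projective.{w₁} S.X₂ (G.obj Y) n
    have := Ext.subsingleton_of_projective.{w₃} (S.map F).X₂ Y n
    exact AddMonoidHom.bijective_of_surjective_of_bijective_of_right_exact _ _ _ _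
      (adj.extAddHom S.X₂ Y n) (adj.extAddHom S.X₁ Y n) (adj.extAddHom S.X₃ Y (n + 1))
      (by ext x; exact (adj.extAddHom_mk₀_comp S.f x).symm)
      (by ext x; exact (adj.extAddHom_extClass_comp hS (add_comm 1 n) x).symm)
      ((ShortComplex.ab_exact_iff_function_exact _).1
        (Ext.contravariant_sequence_exact₁' (hS.map_of_exact F) Y n (n + 1) (add_comm 1 n)))
      ((ShortComplex.ab_exact_iff_function_exact _).1
        (Ext.contravariant_sequence_exact₁' hS (G.obj Y) n (n + 1) (add_comm 1 n)))
      (hn _).surjective (hn _)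
      (fun x ↦ Ext.contravariant_sequence_exact₃ (hS.map_of_exact F) _ x (by subsingleton)
        (add_comm 1 n))
      (fun x ↦ Ext.contravariant_sequence_exact₃ hS _ x (by subsingleton) (add_comm 1 n))

/-- An adjunction `F ⊣ G` of exact functors induces isomorphisms `Extⁿ(F X, Y) ≅ Extⁿ(X, G Y)`. -/
lemma Adjunction.nonempty_ext_addEquiv [PreservesFiniteLimits F] [EnoughProjectives C]
    (adj : F ⊣ G) (X : C) (Y : D) (n : ℕ) :
    Nonempty (Ext.{w₃} (F.obj X) Y n ≃+ Ext.{w₁} X (G.obj Y) n) := by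
  have : G.Additive := G.additive_of_preserves_binary_products
  have : F.Additive := adj.left_adjoint_additive
  exact ⟨AddEquiv.ofBijective (adj.extAddHom X Y n) (adj.extAddHom_bijective X Y n)⟩

end ExtAdjunction

section CommaRight

variable {A : Type u} [Category.{v} A] [Abelian A] {B : Type u'} [Category.{v'} B] [Abelian B]
  (T : B ⥤ A)

/-- The functor `X ↦ (X, 0, 0)` from `A` to the comma category `(T ↓ A)`. -/
@[simps]
def commaOfRight [T.Additive] : A ⥤ Comma T (𝟭 A) where
  obj X := ⟨0, X, 0⟩
  map f := { left := 0, right := f }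

/-- The functor `X ↦ (X, 0, 0)` is left adjoint to the projection `(T ↓ A) ⥤ A`. -/
def commaOfRightAdjunction [T.Additive] : commaOfRight T ⊣ Comma.snd T (𝟭 A) :=
  Adjunction.mkOfHomEquiv
    { homEquiv X Y :=
        { toFun f := f.right
          invFun g :=
            { left := 0
              right := g
              w := (T.map_isZero (isZero_zero B)).eq_of_src _ _ }
          left_inv f := by
            ext
            · exact (isZero_zero B).eq_of_src _ _
            · rfl
          right_inv _ := rfl }
      homEquiv_naturality_left_symm _ _ := by
        ext
        · exact (isZero_zero B).eq_of_src _ _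
        · rfl }

instance [T.Additive] : PreservesFiniteLimits (commaOfRight T) where
  preservesFiniteLimits _ _ _ :=
    { preservesLimit :=
        { preserves hc := ⟨Comma.fstSndJointlyReflectLimit
            { lift _ := 0
              fac _ _ := (isZero_zero B).eq_of_tgt _ _
              uniq _ _ _ := (isZero_zero B).eq_of_tgt _ _ } hc⟩ } }

instance [T.Additive] : PreservesFiniteLimits (Comma.snd T (𝟭 A)) :=
  ⟨fun _ _ _ ↦ (commaOfRightAdjunction T).rightAdjoint_preservesLimits.1⟩

instance [PreservesFiniteColimits T] : PreservesFiniteColimits (Comma.snd T (𝟭 A)) :=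
  ⟨fun _ _ _ ↦ inferInstance⟩

end CommaRight

end CategoryTheory

/-- Lemma 2.4(2):
`Ext^i_{(T↓𝒜)}((X, 0, 0), (N₁, N₂, φ)) ≅ Ext^i_𝒜(X, N₁)` for all `i ≥ 1`. -/
theorem statement3
    {𝒜 : Type u} [Category.{v} 𝒜] [Abelian 𝒜] [EnoughProjectives 𝒜] [EnoughInjectives 𝒜]
    {ℬ : Type u'} [Category.{v'} ℬ] [Abelian ℬ] [EnoughProjectives ℬ] [EnoughInjectives ℬ]
    (T : ℬ ⥤ 𝒜) [T.Additive] [PreservesFiniteColimits T]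
    [Abelian (Comma T (𝟭 𝒜))]
    [HasExt.{w₁} 𝒜] [HasExt.{w₃} (Comma T (𝟭 𝒜))]
    (X : 𝒜) (N₁ : 𝒜) (N₂ : ℬ) (φ : T.obj N₂ ⟶ N₁) (i : ℕ) (hi : 1 ≤ i) :
    Nonempty (Abelian.Ext.{w₃} (⟨0, X, 0⟩ : Comma T (𝟭 𝒜))
      (⟨N₂, N₁, φ⟩ : Comma T (𝟭 𝒜)) i ≃+ Abelian.Ext.{w₁} X N₁ i) := by
  exact (commaOfRightAdjunction T).nonempty_ext_addEquiv X ⟨N₂, N₁, φ⟩ i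
end
end

section
/- Let 𝒜 and ℬ be abelian categories with enough projectives and injectives, T : ℬ → 𝒜 a right exact functor, 𝒳 a class of objects of 𝒜 closed under extensions and kernels of epimorphisms, and 𝒴 a class of objects of ℬ closed under extensions and kernels of epimorphisms, such that (L₁T)(Y) = 0 for every Y ∈ 𝒴. Then 𝔅^𝒳_𝒴 is closed under extensions and under kernels of epimorphisms in the comma category (T↓𝒜): for every short exact sequence 0 → (X₁,Y₁,φ₁) → (X₂,Y₂,φ₂) → (X₃,Y₃,φ₃) → 0 in (T↓𝒜) with (X₃,Y₃,φ₃) ∈ 𝔅^𝒳_𝒴, one has (X₁,Y₁,φ₁) ∈ 𝔅^𝒳_𝒴 if and only if (X₂,Y₂,φ₂) ∈ 𝔅^𝒳_𝒴. -/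
/-!
Formalization of a statement from "Recollements induced by left Frobenius pairs"
(Ma, Sun, Zhu, Hu). Auxiliary definitions (left Frobenius pairs, the classes
`𝒳̂` and `𝔅^𝒳_𝒴`, etc.) are given first; the statement itself is the final theorem.
-/

noncomputable section
open CategoryTheory CategoryTheory.Limits ZeroObject Paper

universe w₁ w₂ w₃ v v' u u'

section ShortExactClosure

variable {𝒜 : Type u} [Category.{v} 𝒜] [Abelian 𝒜]

/-- A class closed under extensions and kernels of epimorphisms is closed under isomorphisms. -/
lemma mem_of_iso_of_closed (𝒳 : Set 𝒜)
    (hX₁ : ∀ S : ShortComplex 𝒜, S.ShortExact → S.X₁ ∈ 𝒳 → S.X₃ ∈ 𝒳 → S.X₂ ∈ 𝒳)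
    (hX₂ : ∀ S : ShortComplex 𝒜, S.ShortExact → S.X₂ ∈ 𝒳 → S.X₃ ∈ 𝒳 → S.X₁ ∈ 𝒳)
    {A B : 𝒜} (e : A ≅ B) (hA : A ∈ 𝒳) : B ∈ 𝒳 := by
  have h0 : (0 : 𝒜) ∈ 𝒳 :=
    hX₂ (ShortComplex.mk (0 : (0 : 𝒜) ⟶ A) (𝟙 A) zero_comp)
      { exact := ShortComplex.exact_of_f_is_kernel _
          (KernelFork.IsLimit.ofMonoOfIsZero _ inferInstance (isZero_zero _))
        mono_f := inferInstance
        epi_g := inferInstance } hA hA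
  exact hX₁ (ShortComplex.mk e.hom (0 : B ⟶ (0 : 𝒜)) (by simp))
    { exact := (ShortComplex.exact_iff_epi _ rfl).2 inferInstance
      mono_f := inferInstance
      epi_g := ⟨fun _ _ _ => (isZero_zero 𝒜).eq_of_src _ _⟩ } hA h0

/-- Given a morphism of short exact sequences whose third component is a monomorphism, the
cokernels form a short exact sequence. -/
lemma shortExact_cokernel {S₁ S₂ : ShortComplex 𝒜} (h₁ : S₁.ShortExact) (h₂ : S₂.ShortExact)
    (φ : S₁ ⟶ S₂) [Mono φ.τ₃] :
    ∃ S : ShortComplex 𝒜, S.ShortExact ∧ Nonempty (S.X₁ ≅ cokernel φ.τ₁) ∧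
      Nonempty (S.X₂ ≅ cokernel φ.τ₂) ∧ Nonempty (S.X₃ ≅ cokernel φ.τ₃) := by
  have := h₁.epi_g
  have := h₂.mono_f
  let I : ShortComplex.SnakeInput 𝒜 :=
    { L₀ := kernel φ
      L₁ := S₁
      L₂ := S₂
      L₃ := cokernel φ
      v₀₁ := kernel.ι φ
      v₁₂ := φ
      v₂₃ := cokernel.π φ
      w₀₂ := kernel.condition φ
      w₁₃ := cokernel.condition φ
      h₀ := kernelIsKernel φ
      h₃ := cokernelIsCokernel φ
      L₁_exact := h₁.exact
      L₂_exact := h₂.exact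
      epi_L₁_g := inferInstance
      mono_L₂_f := inferInstance }
  have hδ : I.δ = 0 := by
    have h0 : I.v₀₁.τ₃ = 0 := by
      rw [← cancel_mono φ.τ₃, zero_comp]
      exact I.w₀₂_τ₃
    have := I.mono_v₀₁_τ₃
    have hz : IsZero I.L₀.X₃ := IsZero.of_mono_eq_zero I.v₀₁.τ₃ h0
    exact hz.eq_of_src _ _
  have : Epi I.L₂.g := h₂.epi_g
  exact ⟨I.L₃, .mk' I.L₃_exact (I.L₂'_exact.mono_g hδ) I.epi_L₃_g,
    ⟨I.h₃τ₁.coconePointUniqueUpToIso (colimit.isColimit _)⟩,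
    ⟨I.h₃τ₂.coconePointUniqueUpToIso (colimit.isColimit _)⟩,
    ⟨I.h₃τ₃.coconePointUniqueUpToIso (colimit.isColimit _)⟩⟩

end ShortExactClosure

section RightExact

variable {𝒜 : Type u} [Category.{v} 𝒜] [Abelian 𝒜]
  {ℬ : Type u'} [Category.{v'} ℬ] [Abelian ℬ]
  (T : ℬ ⥤ 𝒜) [T.Additive] [PreservesFiniteColimits T]

/-- A right exact functor sends a short exact sequence to a short exact sequence if its first
left derived functor vanishes on the third term. -/
lemma shortExact_map_of_isZero_leftDerived [EnoughProjectives ℬ]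
    {S : ShortComplex ℬ} (hS : S.ShortExact)
    (h : IsZero ((T.leftDerived 1).obj S.X₃)) : (S.map T).ShortExact := by
  have := hS.epi_g
  have := hS.mono_f
  obtain ⟨P⟩ := (inferInstance : HasProjectiveResolution S.X₃).out
  have hP₁ : (ShortComplex.mk (T.map (P.complex.d 2 1)) (T.map (P.complex.d 1 0))
      (by rw [← T.map_comp]; simp)).Exact :=
    (HomologicalComplex.exactAt_iff' _ 2 1 0 (by simp) (by simp)).1
      ((HomologicalComplex.exactAt_iff_isZero_homology _ _).2
        (h.of_iso (P.isoLeftDerivedObj T 1).symm))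
  let π : P.complex.X 0 ⟶ S.X₃ := P.π.f 0
  have hdπ : P.complex.d 1 0 ≫ π = 0 := P.complex_d_comp_π_f_zero
  have hP₀ : (ShortComplex.mk _ _ hdπ).Exact := P.exact₀
  let p₀ : P.complex.X 0 ⟶ S.X₂ := Projective.factorThru π S.g
  have hp₀ : p₀ ≫ S.g = π := Projective.factorThru_comp _ _
  let p₁ : P.complex.X 1 ⟶ S.X₁ := hS.exact.lift (P.complex.d 1 0 ≫ p₀) (by simp [hp₀, hdπ])
  have hp₁ : p₁ ≫ S.f = P.complex.d 1 0 ≫ p₀ := hS.exact.lift_f _ _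
  have hdp₁ : P.complex.d 2 1 ≫ p₁ = 0 := by simp [← cancel_mono S.f, hp₁]
  let R : ShortComplex ℬ := ShortComplex.mk (biprod.lift (-p₁) (P.complex.d 1 0))
    (biprod.desc S.f p₀) (by simp [hp₁])
  have : Epi π := inferInstanceAs (Epi (P.π.f 0))
  have hR : R.Exact := by
    rw [ShortComplex.exact_iff_exact_up_to_refinements]
    intro A x hx
    have hx' : (x ≫ biprod.fst) ≫ S.f + (x ≫ biprod.snd) ≫ p₀ = 0 := by
      rw [← hx]
      simp [R, biprod.desc_eq]
    have hxπ : (x ≫ biprod.snd) ≫ π = 0 := by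
      have := congr($hx' ≫ S.g)
      simpa [hp₀] using this
    obtain ⟨A', q, hq, z, hz⟩ := hP₀.exact_up_to_refinements _ hxπ
    dsimp at hz
    refine ⟨A', q, hq, z, biprod.hom_ext _ _ ?_ ?_⟩
    · rw [← cancel_mono S.f]
      have h1 := congr(q ≫ $hx')
      have h2 := congr($hz ≫ p₀)
      simp only [Preadditive.comp_add, comp_zero, Category.assoc] at h1 h2
      rw [h2, ← hp₁] at h1
      simpa [R] using eq_neg_of_add_eq_zero_left h1
    · simpa [R] using hz
  have hRg : Epi R.g := by
    rw [Preadditive.epi_iff_cancel_zero]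
    intro Z t ht
    have hf : S.f ≫ t = 0 := by simpa [R] using congr(biprod.inl ≫ $ht)
    have hp : p₀ ≫ t = 0 := by simpa [R] using congr(biprod.inr ≫ $ht)
    rw [← hS.exact.g_desc t hf] at hp ⊢
    rw [reassoc_of% hp₀] at hp
    rw [zero_of_epi_comp π hp, comp_zero]
  have hTR : (R.map T).Exact := hR.map_of_epi_of_preservesCokernel T hRg inferInstance
  refine .mk' (hS.exact.map_of_epi_of_preservesCokernel T inferInstance inferInstance) ?_
    (inferInstanceAs (Epi (T.map S.g)))
  refine (Preadditive.mono_iff_cancel_zero (T.map S.f)).2 fun A a ha => ?_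
  have ha' : (a ≫ T.map biprod.inl) ≫ T.map (biprod.desc S.f p₀) = 0 := by
    rw [Category.assoc, ← T.map_comp, biprod.inl_desc, ha]
  obtain ⟨A', q, hq, (z : A' ⟶ T.obj (P.complex.X 1)),
    (hz : q ≫ a ≫ T.map biprod.inl = z ≫ T.map (biprod.lift (-p₁) (P.complex.d 1 0)))⟩ :=
    hTR.exact_up_to_refinements (a ≫ T.map biprod.inl) ha'
  have h1 := congr($hz ≫ T.map biprod.fst)
  have h2 := congr($hz ≫ T.map biprod.snd)
  simp only [Category.assoc, ← T.map_comp, biprod.inl_fst, biprod.inl_snd, biprod.lift_fst,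
    biprod.lift_snd, T.map_id, T.map_zero, comp_zero, Category.comp_id] at h1 h2
  obtain ⟨A'', q', hq', (w : A'' ⟶ T.obj (P.complex.X 2)),
    (hw : q' ≫ z = w ≫ T.map (P.complex.d 2 1))⟩ := hP₁.exact_up_to_refinements z h2.symm
  rw [← cancel_epi q, ← cancel_epi q', h1, reassoc_of% hw, ← T.map_comp]
  simp [hdp₁]

instance preservesFiniteLimits_comma_fst : PreservesFiniteLimits (Comma.fst T (𝟭 𝒜)) where
  preservesFiniteLimits _ _ _ :=
    { preservesLimit := preservesLimit_of_preserves_limit_cone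
        (Comma.coneOfPreservesIsLimit _ (limit.isLimit _) (limit.isLimit _)) (limit.isLimit _) }

instance preservesFiniteLimits_comma_snd : PreservesFiniteLimits (Comma.snd T (𝟭 𝒜)) where
  preservesFiniteLimits _ _ _ :=
    { preservesLimit := preservesLimit_of_preserves_limit_cone
        (Comma.coneOfPreservesIsLimit _ (limit.isLimit _) (limit.isLimit _)) (limit.isLimit _) }

instance preservesFiniteColimits_comma_fst : PreservesFiniteColimits (Comma.fst T (𝟭 𝒜)) where
  preservesFiniteColimits _ _ _ := inferInstance

instance preservesFiniteColimits_comma_snd : PreservesFiniteColimits (Comma.snd T (𝟭 𝒜)) where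
  preservesFiniteColimits _ _ _ := inferInstance

end RightExact

/-- if `𝒳` and `𝒴` are closed under extensions and kernels of
epimorphisms and `(L₁T)(𝒴) = 0`, then `𝔅^𝒳_𝒴` is closed under extensions and kernels
of epimorphisms in `(T ↓ 𝒜)`. -/
theorem statement4
    {𝒜 : Type u} [Category.{v} 𝒜] [Abelian 𝒜] [EnoughProjectives 𝒜] [EnoughInjectives 𝒜]
    {ℬ : Type u'} [Category.{v'} ℬ] [Abelian ℬ] [EnoughProjectives ℬ] [EnoughInjectives ℬ]
    (T : ℬ ⥤ 𝒜) [T.Additive] [PreservesFiniteColimits T]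
    [Abelian (Comma T (𝟭 𝒜))]
    (𝒳 : Set 𝒜) (𝒴 : Set ℬ)
    (hX₁ : ∀ S : ShortComplex 𝒜, S.ShortExact → S.X₁ ∈ 𝒳 → S.X₃ ∈ 𝒳 → S.X₂ ∈ 𝒳)
    (hX₂ : ∀ S : ShortComplex 𝒜, S.ShortExact → S.X₂ ∈ 𝒳 → S.X₃ ∈ 𝒳 → S.X₁ ∈ 𝒳)
    (hY₁ : ∀ S : ShortComplex ℬ, S.ShortExact → S.X₁ ∈ 𝒴 → S.X₃ ∈ 𝒴 → S.X₂ ∈ 𝒴)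
    (hY₂ : ∀ S : ShortComplex ℬ, S.ShortExact → S.X₂ ∈ 𝒴 → S.X₃ ∈ 𝒴 → S.X₁ ∈ 𝒴)
    (hL₁ : ∀ Y ∈ 𝒴, IsZero ((T.leftDerived 1).obj Y))
    (S : ShortComplex (Comma T (𝟭 𝒜))) (hS : S.ShortExact)
    (h₃ : S.X₃ ∈ CommaClass T 𝒳 𝒴) :
    S.X₁ ∈ CommaClass T 𝒳 𝒴 ↔ S.X₂ ∈ CommaClass T 𝒳 𝒴 := by
  have hl : (S.map (Comma.fst T (𝟭 𝒜))).ShortExact := hS.map_of_exact _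
  have hr : (S.map (Comma.snd T (𝟭 𝒜))).ShortExact := hS.map_of_exact _
  obtain ⟨hY₃, hm₃, hc₃⟩ := h₃
  have hT : ((S.map (Comma.fst T (𝟭 𝒜))).map T).ShortExact :=
    shortExact_map_of_isZero_leftDerived T hl (hL₁ _ hY₃)
  let φ : (S.map (Comma.fst T (𝟭 𝒜))).map T ⟶ S.map (Comma.snd T (𝟭 𝒜)) :=
    { τ₁ := S.X₁.hom
      τ₂ := S.X₂.hom
      τ₃ := S.X₃.hom
      comm₁₂ := S.f.w.symm
      comm₂₃ := S.g.w.symm }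
  have : Mono φ.τ₃ := hm₃
  obtain ⟨C, hC, ⟨e₁⟩, ⟨e₂⟩, ⟨e₃⟩⟩ := shortExact_cokernel hT hr φ
  have hmem : ∀ {A B : 𝒜}, (A ≅ B) → MemIso 𝒳 B → A ∈ 𝒳 := fun e ⟨_, hX, ⟨i⟩⟩ =>
    mem_of_iso_of_closed 𝒳 hX₁ hX₂ (i ≪≫ e.symm) hX
  have hC₃ : C.X₃ ∈ 𝒳 := hmem e₃ hc₃
  constructor
  · rintro ⟨hY, hm, hc⟩
    have : Mono φ.τ₁ := hm
    have := hT.mono_f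
    have := hr.mono_f
    exact ⟨hY₁ _ hl hY hY₃, ShortComplex.mono_τ₂_of_exact_of_mono φ hT.exact, _, hX₁ C hC (hmem e₁ hc) hC₃, ⟨e₂⟩⟩
  · rintro ⟨hY, hm, hc⟩
    have : Mono (S.X₁.hom ≫ S.f.right) := by
      have h : T.map S.f.left ≫ S.X₂.hom = S.X₁.hom ≫ S.f.right := S.f.w
      rw [← h]
      exact mono_comp' hT.mono_f hm
    exact ⟨hY₂ _ hl hY hY₃, mono_of_mono _ S.f.right, _, hX₂ C hC (hmem e₂ hc) hC₃, ⟨e₁⟩⟩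
end
end

section
/- Let 𝒜 and ℬ be abelian categories with enough projectives and injectives, T : ℬ → 𝒜 a right exact functor, (𝒳,𝒲) a left Frobenius pair in 𝒜 and (𝒴,𝒱) a left Frobenius pair in ℬ, with T(V) ∈ 𝒲̂ for every V ∈ 𝒱 and (L_nT)(Y) = 0 for every Y ∈ 𝒴 and every n ≥ 1. Then for every (X,Y,φ) ∈ 𝔅^𝒳_𝒴 and every (W,V,ψ) ∈ 𝔅^𝒲_𝒱 one has Ext^i_{(T↓𝒜)}((X,Y,φ), (W,V,ψ)) = 0 for all i ≥ 1; that is, 𝔅^𝒲_𝒱 ⊆ (𝔅^𝒳_𝒴)^⊥. -/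
/-!
Formalization of a statement from "Recollements induced by left Frobenius pairs"
(Ma, Sun, Zhu, Hu). Auxiliary definitions (left Frobenius pairs, the classes
`𝒳̂` and `𝔅^𝒳_𝒴`, etc.) are given first; the statement itself is the final theorem.
-/

noncomputable section
open CategoryTheory CategoryTheory.Limits ZeroObject Paper

universe w₁ w₂ w₃ v v' u u'

namespace Paper

section ExtVanishing
variable {𝒞 : Type u} [Category.{v} 𝒞] [Abelian 𝒞] [HasExt.{w₁} 𝒞]

lemma subsingleton_ext_of_iso_right {X C D : 𝒞} (e : C ≅ D) (n : ℕ)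
    [Subsingleton (Abelian.Ext.{w₁} X C n)] : Subsingleton (Abelian.Ext.{w₁} X D n) := by
  refine subsingleton_of_forall_eq 0 fun x => ?_
  have h : x.comp (Abelian.Ext.mk₀ e.inv) (add_zero n) = 0 := Subsingleton.elim _ _
  have h' : (x.comp (Abelian.Ext.mk₀ e.inv) (add_zero n)).comp
      (Abelian.Ext.mk₀ e.hom) (add_zero n) = x := by simp
  rw [← h', h, Abelian.Ext.zero_comp]

lemma subsingleton_ext_of_shortExact_left {S : ShortComplex 𝒞} (hS : S.ShortExact) (M : 𝒞)
    (n : ℕ) [Subsingleton (Abelian.Ext.{w₁} S.X₁ M n)]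
    [Subsingleton (Abelian.Ext.{w₁} S.X₃ M n)] : Subsingleton (Abelian.Ext.{w₁} S.X₂ M n) := by
  refine subsingleton_of_forall_eq 0 fun x => ?_
  obtain ⟨y, rfl⟩ := Abelian.Ext.contravariant_sequence_exact₂ hS M x (Subsingleton.elim _ _)
  rw [Subsingleton.elim y 0, Abelian.Ext.comp_zero]

lemma subsingleton_ext_of_shortExact_right {S : ShortComplex 𝒞} (hS : S.ShortExact) (X : 𝒞)
    (n : ℕ) [Subsingleton (Abelian.Ext.{w₁} X S.X₁ n)]
    [Subsingleton (Abelian.Ext.{w₁} X S.X₃ n)] : Subsingleton (Abelian.Ext.{w₁} X S.X₂ n) := by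
  refine subsingleton_of_forall_eq 0 fun x => ?_
  obtain ⟨y, rfl⟩ := Abelian.Ext.covariant_sequence_exact₂ X hS x (Subsingleton.elim _ _)
  rw [Subsingleton.elim y 0, Abelian.Ext.zero_comp]

lemma subsingleton_ext_hat {𝒲 : Set 𝒞} {X : 𝒞}
    (h : ∀ W ∈ 𝒲, ∀ i : ℕ, 1 ≤ i → Subsingleton (Abelian.Ext.{w₁} X W i))
    {C : 𝒞} (hC : C ∈ Hat 𝒲) (i : ℕ) (hi : 1 ≤ i) : Subsingleton (Abelian.Ext.{w₁} X C i) := by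
  obtain ⟨n, hn⟩ := hC
  induction n generalizing C i with
  | zero =>
    obtain ⟨W, hW, ⟨e⟩⟩ := hn
    have := h W hW i hi
    exact subsingleton_ext_of_iso_right e i
  | succ n ih =>
    obtain ⟨S, hS, rfl, h₂, h₁⟩ := hn
    refine subsingleton_of_forall_eq 0 fun x => ?_
    have := ih (i + 1) (by omega) h₁
    have := h _ h₂ i hi
    obtain ⟨y, rfl⟩ := Abelian.Ext.covariant_sequence_exact₃ X hS x rfl (Subsingleton.elim _ _)
    rw [Subsingleton.elim y 0, Abelian.Ext.zero_comp]

end ExtVanishing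

lemma exists_shortExact_of_memIso_cokernel {𝒞 : Type u} [Category.{v} 𝒞] [Abelian 𝒞]
    {𝒳 : Set 𝒞} {A B : 𝒞} (f : A ⟶ B) [Mono f]
    (h : MemIso 𝒳 (cokernel f)) :
    ∃ X ∈ 𝒳, ∃ (g : B ⟶ X) (w : f ≫ g = 0), (ShortComplex.mk f g w).ShortExact := by
  obtain ⟨X, hX, ⟨e⟩⟩ := h
  refine ⟨X, hX, cokernel.π f ≫ e.inv, by simp, ?_⟩
  refine ShortComplex.shortExact_of_iso (S₁ := ShortComplex.mk f (cokernel.π f) (by simp))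
    (ShortComplex.isoMk (Iso.refl _) (Iso.refl _) e.symm (by simp) (by simp)) ?_
  exact ShortComplex.ShortExact.mk' (ShortComplex.exact_cokernel f) inferInstance inferInstance

section Adjunction
variable {𝒞 : Type u} [Category.{v} 𝒞] [Abelian 𝒞] [HasExt.{w₁} 𝒞]
  {𝒟 : Type u'} [Category.{v'} 𝒟] [Abelian 𝒟] [HasExt.{w₂} 𝒟]

/-- Vanishing of `Ext` transfers along an adjunction `F ⊣ G` on a class `𝒮` of objects which is
closed under suitable syzygies, on which `F` is exact. -/
lemma subsingleton_ext_of_adjunction {F : 𝒞 ⥤ 𝒟} {G : 𝒟 ⥤ 𝒞} (adj : F ⊣ G)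
    [G.PreservesEpimorphisms] [F.PreservesZeroMorphisms] (𝒮 : Set 𝒞)
    (h𝒮 : ∀ X ∈ 𝒮, ∃ S : ShortComplex 𝒞, S.ShortExact ∧ S.X₃ = X ∧ Projective S.X₂ ∧
      S.X₁ ∈ 𝒮 ∧ (S.map F).ShortExact)
    (M : 𝒟) {X : 𝒞} (hX : X ∈ 𝒮)
    (hM : ∀ i : ℕ, 1 ≤ i → Subsingleton (Abelian.Ext.{w₁} X (G.obj M) i))
    (i : ℕ) (hi : 1 ≤ i) : Subsingleton (Abelian.Ext.{w₂} (F.obj X) M i) := by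
  induction i, hi using Nat.le_induction generalizing X with
  | base =>
    obtain ⟨S, hS, rfl, hP, -, hFS⟩ := h𝒮 X hX
    refine subsingleton_of_forall_eq 0 fun x => ?_
    have : Projective (S.map F).X₂ := adj.map_projective _ hP
    obtain ⟨y, rfl⟩ := Abelian.Ext.contravariant_sequence_exact₃ hFS M x
      (Abelian.Ext.eq_zero_of_projective (n := 0) _) (n₀ := 0) rfl
    obtain ⟨f, rfl⟩ := Abelian.Ext.addEquiv₀.symm.surjective y
    have := hM 1 le_rfl
    obtain ⟨z, hz⟩ := Abelian.Ext.contravariant_sequence_exact₁ hS (G.obj M)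
      (Abelian.Ext.mk₀ (adj.homEquiv _ _ f)) rfl (Subsingleton.elim _ _)
    obtain ⟨g, rfl⟩ := Abelian.Ext.addEquiv₀.symm.surjective z
    have hg : S.f ≫ g = adj.homEquiv _ _ f := by
      apply Abelian.Ext.addEquiv₀.symm.injective
      simpa using hz
    let g' : (S.map F).X₂ ⟶ M := (adj.homEquiv _ _).symm g
    obtain rfl : f = (S.map F).f ≫ g' :=
      ((adj.homEquiv _ _).eq_symm_apply.2 hg.symm).trans
        (adj.homEquiv_naturality_left_symm S.f g)
    rw [Abelian.Ext.addEquiv₀_symm_apply, ← Abelian.Ext.mk₀_comp_mk₀]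
    exact hFS.extClass_comp_assoc _
  | succ i hi ih =>
    obtain ⟨S, hS, rfl, hP, h₁, hFS⟩ := h𝒮 X hX
    refine subsingleton_of_forall_eq 0 fun x => ?_
    have : Projective (S.map F).X₂ := adj.map_projective _ hP
    obtain ⟨y, rfl⟩ := Abelian.Ext.contravariant_sequence_exact₃ hFS M x
      (Abelian.Ext.eq_zero_of_projective _) (n₀ := i) (Nat.add_comm 1 i)
    have hK : ∀ j : ℕ, 1 ≤ j → Subsingleton (Abelian.Ext.{w₁} S.X₁ (G.obj M) j) := by
      intro j hj
      refine subsingleton_of_forall_eq 0 fun t => ?_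
      have := hM (j + 1) (by omega)
      obtain ⟨s, rfl⟩ := Abelian.Ext.contravariant_sequence_exact₁ hS (G.obj M) t
        (Nat.add_comm 1 j) (Subsingleton.elim _ _)
      obtain ⟨k, rfl⟩ := Nat.exists_eq_add_of_le' hj
      rw [Abelian.Ext.eq_zero_of_projective s, Abelian.Ext.comp_zero]
    have : Subsingleton (Abelian.Ext.{w₂} (S.map F).X₁ M i) := ih h₁ hK
    rw [Subsingleton.elim y 0]
    exact Abelian.Ext.comp_zero _ _ _ _ _

end Adjunction

section Acyclic
variable {ℬ : Type u'} [Category.{v'} ℬ] [Abelian ℬ] {𝒜 : Type u} [Category.{v} 𝒜] [Abelian 𝒜]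

lemma mono_of_exact_of_comp_eq {A B C Q : 𝒜} {f : A ⟶ B} {g : B ⟶ C} {w : f ≫ g = 0}
    (h : (ShortComplex.mk f g w).Exact) (π : B ⟶ Q) [Epi π] (hπ : f ≫ π = 0) (j : Q ⟶ C)
    (hj : π ≫ j = g) : Mono j := by
  refine Preadditive.mono_of_cancel_zero _ fun {R} x hx => ?_
  obtain ⟨R₁, p₁, _, y, hy⟩ := surjective_up_to_refinements_of_epi π x
  obtain ⟨R₂, p₂, _, z, hz⟩ := h.exact_up_to_refinements y (by
    simp [← hj, ← reassoc_of% hy, hx])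
  dsimp at hz
  rw [← cancel_epi p₁, hy, ← cancel_epi p₂, reassoc_of% hz, hπ]
  simp

/-- The objects which are syzygies of a projective resolution `P`. -/
def syzygies {Y : ℬ} (P : ProjectiveResolution Y) : Set ℬ :=
  {X | ∃ (n : ℕ) (π : P.complex.X n ⟶ X) (w : P.complex.d (n + 1) n ≫ π = 0),
    Epi π ∧ (ShortComplex.mk _ π w).Exact}

lemma mem_syzygies_self {Y : ℬ} (P : ProjectiveResolution Y) : Y ∈ syzygies P :=
  ⟨0, P.π.f 0, P.complex_d_comp_π_f_zero, inferInstanceAs (Epi (P.π.f 0)), P.exact₀⟩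

lemma exists_shortExact_of_mem_syzygies [EnoughProjectives ℬ] (T : ℬ ⥤ 𝒜) [T.Additive]
    [PreservesFiniteColimits T] {Y : ℬ} (P : ProjectiveResolution Y)
    (hT : ∀ n : ℕ, 1 ≤ n → IsZero ((T.leftDerived n).obj Y)) (X : ℬ) (hX : X ∈ syzygies P) :
    ∃ S : ShortComplex ℬ, S.ShortExact ∧ S.X₃ = X ∧ Projective S.X₂ ∧
      S.X₁ ∈ syzygies P ∧ (S.map T).ShortExact := by
  obtain ⟨n, π, w, hπ, hex⟩ := hX
  let κ := cokernel.π (P.complex.d (n + 2) (n + 1))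
  let j : cokernel (P.complex.d (n + 2) (n + 1)) ⟶ P.complex.X n :=
    cokernel.desc _ (P.complex.d (n + 1) n) (by simp)
  have hκj : κ ≫ j = P.complex.d (n + 1) n := cokernel.π_desc _ _ _
  have hjπ : j ≫ π = 0 := by rw [← cancel_epi κ, reassoc_of% hκj, w, comp_zero]
  have hdκ : P.complex.d (n + 2) (n + 1) ≫ κ = 0 := cokernel.condition _
  have hκ := ShortComplex.exact_cokernel (P.complex.d (n + 2) (n + 1))
  have : Mono j := mono_of_exact_of_comp_eq (P.exact_succ n) κ hdκ j hκj
  have hj : (ShortComplex.mk j π hjπ).Exact := by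
    let φ : ShortComplex.mk _ π w ⟶ ShortComplex.mk j π hjπ :=
      { τ₁ := κ, τ₂ := 𝟙 _, τ₃ := 𝟙 _ }
    have : Epi φ.τ₁ := inferInstanceAs (Epi (cokernel.π _))
    have : IsIso φ.τ₂ := inferInstanceAs (IsIso (𝟙 _))
    have : Mono φ.τ₃ := inferInstanceAs (Mono (𝟙 _))
    exact (ShortComplex.exact_iff_of_epi_of_isIso_of_mono φ).1 hex
  have hTex : ((ShortComplex.mk _ _ (P.complex.d_comp_d (n + 2) (n + 1) n)).map T).Exact := by
    have h := (hT (n + 1) (by omega)).of_iso (P.isoLeftDerivedObj T (n + 1)).symm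
    have h' := (HomologicalComplex.exactAt_iff_isZero_homology _ _).2 h
    exact (HomologicalComplex.exactAt_iff' _ (n + 2) (n + 1) n (by simp) (by simp)).1 h'
  refine ⟨ShortComplex.mk j π hjπ, .mk' hj inferInstance hπ, rfl, P.projective n,
    ⟨n + 1, κ, hdκ, inferInstanceAs (Epi (cokernel.π _)), hκ⟩, .mk' ?_ ?_ ?_⟩
  · exact hj.map_of_epi_of_preservesCokernel T hπ inferInstance
  · exact mono_of_exact_of_comp_eq hTex (T.map κ)
      ((T.map_comp _ _).symm.trans (by rw [hdκ, T.map_zero])) _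
      ((T.map_comp _ _).symm.trans (by rw [hκj]))
  · exact inferInstanceAs (Epi (T.map π))

end Acyclic

section Gluing
variable {𝒜 : Type u} [Category.{v} 𝒜] [Abelian 𝒜] {ℬ : Type u'} [Category.{v'} ℬ] [Abelian ℬ]
  {𝒟 : Type*} [Category* 𝒟] [Abelian 𝒟] {p : 𝒟 ⥤ ℬ} {q : 𝒟 ⥤ 𝒜}
  [PreservesFiniteLimits p] [PreservesFiniteColimits p]
  [PreservesFiniteLimits q] [PreservesFiniteColimits q]

lemma shortExact_of_jointly_faithful
    (hpq : ∀ {X Y : 𝒟} (f g : X ⟶ Y), p.map f = p.map g → q.map f = q.map g → f = g)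
    (S : ShortComplex 𝒟) (hp : (S.map p).ShortExact) (hq : (S.map q).ShortExact) :
    S.ShortExact := by
  refine .mk' ?_ ⟨fun a b h => ?_⟩ ⟨fun a b h => ?_⟩
  · rw [ShortComplex.exact_iff_isZero_homology, IsZero.iff_id_eq_zero]
    apply hpq
    · exact (((ShortComplex.exact_iff_isZero_homology _).1 hp.exact).of_iso
        (S.mapHomologyIso p).symm).eq_of_src _ _
    · exact (((ShortComplex.exact_iff_isZero_homology _).1 hq.exact).of_iso
        (S.mapHomologyIso q).symm).eq_of_src _ _
  · apply hpq
    · have : Mono (p.map S.f) := hp.mono_f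
      simpa [cancel_mono] using congrArg p.map h
    · have : Mono (q.map S.f) := hq.mono_f
      simpa [cancel_mono] using congrArg q.map h
  · apply hpq
    · have : Epi (p.map S.g) := hp.epi_g
      simpa [cancel_epi] using congrArg p.map h
    · have : Epi (q.map S.g) := hq.epi_g
      simpa [cancel_epi] using congrArg q.map h

lemma shortExact_of_isZero (S : ShortComplex 𝒜) (h₁ : IsZero S.X₁) (h₂ : IsZero S.X₂)
    (h₃ : IsZero S.X₃) : S.ShortExact :=
  .mk' (ShortComplex.exact_of_isZero_X₂ _ h₂) ⟨fun _ _ _ => h₁.eq_of_tgt _ _⟩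
    ⟨fun _ _ _ => h₃.eq_of_src _ _⟩

/-- The vanishing of `Ext` in an abelian category `𝒟` glued from `ℬ` and `𝒜` along `T`, stated in
terms of the exact projections `p`, `q` and their left adjoints `F₂`, `F₁`. -/
lemma subsingleton_ext_of_gluing [EnoughProjectives 𝒜] [EnoughProjectives ℬ]
    [HasExt.{w₁} 𝒜] [HasExt.{w₂} ℬ] [HasExt.{w₃} 𝒟]
    (hpq : ∀ {X Y : 𝒟} (f g : X ⟶ Y), p.map f = p.map g → q.map f = q.map g → f = g)
    (T : ℬ ⥤ 𝒜) [T.Additive] [PreservesFiniteColimits T]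
    {F₁ : 𝒜 ⥤ 𝒟} (adj₁ : F₁ ⊣ q) (e₁ : F₁ ⋙ q ≅ 𝟭 𝒜) (h₁ : ∀ A, IsZero (p.obj (F₁.obj A)))
    {F₂ : ℬ ⥤ 𝒟} (adj₂ : F₂ ⊣ p) (e₂ : F₂ ⋙ p ≅ 𝟭 ℬ) (e₂' : F₂ ⋙ q ≅ T)
    {X : 𝒜} {Y : ℬ} {Z M : 𝒟} (f : F₂.obj Y ⟶ Z) (g : Z ⟶ F₁.obj X)
    (wp : p.map f ≫ p.map g = 0) (hp : (ShortComplex.mk _ _ wp).ShortExact)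
    (wq : q.map f ≫ q.map g = 0) (hq : (ShortComplex.mk _ _ wq).ShortExact)
    (hX : ∀ i : ℕ, 1 ≤ i → Subsingleton (Abelian.Ext.{w₁} X (q.obj M) i))
    (hY : ∀ i : ℕ, 1 ≤ i → Subsingleton (Abelian.Ext.{w₂} Y (p.obj M) i))
    (hT : ∀ n : ℕ, 1 ≤ n → IsZero ((T.leftDerived n).obj Y))
    (i : ℕ) (hi : 1 ≤ i) : Subsingleton (Abelian.Ext.{w₃} Z M i) := by
  have := adj₁.isLeftAdjoint
  have := adj₂.isLeftAdjoint
  have hw : f ≫ g = 0 := hpq _ _ (by simpa using wp) (by simpa using wq)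
  have hS : (ShortComplex.mk f g hw).ShortExact := shortExact_of_jointly_faithful hpq _ hp hq
  have : Subsingleton (Abelian.Ext.{w₃} (ShortComplex.mk f g hw).X₃ M i) := by
    refine subsingleton_ext_of_adjunction adj₁ Set.univ (fun A _ => ?_) M (Set.mem_univ X) hX i hi
    let S := ShortComplex.mk (kernel.ι (Projective.π A)) (Projective.π A) (by simp)
    have hS : S.ShortExact := .mk' (ShortComplex.exact_kernel _) inferInstance inferInstance
    refine ⟨S, hS, rfl, Projective.projective_over A, Set.mem_univ _,
      shortExact_of_jointly_faithful hpq _ ?_ ?_⟩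
    · exact shortExact_of_isZero _ (h₁ _) (h₁ _) (h₁ _)
    · exact ShortComplex.shortExact_of_iso (S.mapNatIso e₁).symm hS
  have : Subsingleton (Abelian.Ext.{w₃} (ShortComplex.mk f g hw).X₁ M i) := by
    let P := ProjectiveResolution.of Y
    refine subsingleton_ext_of_adjunction adj₂ (syzygies P) (fun B hB => ?_) M
      (mem_syzygies_self P) hY i hi
    obtain ⟨S, hS, h₃, h₂, hS₁, hTS⟩ := exists_shortExact_of_mem_syzygies T P hT B hB
    refine ⟨S, hS, h₃, h₂, hS₁, shortExact_of_jointly_faithful hpq _ ?_ ?_⟩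
    · exact ShortComplex.shortExact_of_iso (S.mapNatIso e₂).symm hS
    · exact ShortComplex.shortExact_of_iso (S.mapNatIso e₂').symm hTS
  exact subsingleton_ext_of_shortExact_left hS M i

end Gluing

section CommaFunctors
variable {𝒜 : Type u} [Category.{v} 𝒜] {ℬ : Type u'} [Category.{v'} ℬ] (T : ℬ ⥤ 𝒜)

lemma preservesLimitsOfShape_comma_fst (J : Type*) [Category* J] [HasLimitsOfShape J 𝒜]
    [HasLimitsOfShape J ℬ] : PreservesLimitsOfShape J (Comma.fst T (𝟭 𝒜)) where
  preservesLimit :=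
    preservesLimit_of_preserves_limit_cone
      (Comma.coneOfPreservesIsLimit _ (limit.isLimit _) (limit.isLimit _)) (limit.isLimit _)

lemma preservesLimitsOfShape_comma_snd (J : Type*) [Category* J] [HasLimitsOfShape J 𝒜]
    [HasLimitsOfShape J ℬ] : PreservesLimitsOfShape J (Comma.snd T (𝟭 𝒜)) where
  preservesLimit :=
    preservesLimit_of_preserves_limit_cone
      (Comma.coneOfPreservesIsLimit _ (limit.isLimit _) (limit.isLimit _)) (limit.isLimit _)

/-- The functor `Y ↦ (T Y, Y, 𝟙)`. -/
def commaFree : ℬ ⥤ Comma T (𝟭 𝒜) where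
  obj Y := { left := Y, right := T.obj Y, hom := 𝟙 _ }
  map f := { left := f, right := T.map f }

/-- The functor `Y ↦ (T Y, Y, 𝟙)` is left adjoint to the projection to `ℬ`. -/
def commaFreeAdj : commaFree T ⊣ Comma.fst T (𝟭 𝒜) :=
  Adjunction.mkOfHomEquiv
    { homEquiv := fun Y Z =>
        { toFun := fun f => f.left
          invFun := fun g => { left := g, right := T.map g ≫ Z.hom, w := (Category.id_comp _).symm }
          left_inv := fun f => by
            ext
            · rfl
            · exact f.w.trans (Category.id_comp _)
          right_inv := fun g => rfl }
      homEquiv_naturality_left_symm := fun {_ _ Z} f g => by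
        ext
        · rfl
        · exact (congrArg (· ≫ Z.hom) (T.map_comp f g)).trans (Category.assoc _ _ _) }

variable [Abelian 𝒜] [Abelian ℬ] [T.Additive]

/-- The functor `X ↦ (X, 0, 0)`. -/
def commaZero : 𝒜 ⥤ Comma T (𝟭 𝒜) where
  obj X := { left := 0, right := X, hom := 0 }
  map f := { left := 𝟙 _, right := f }

/-- The functor `X ↦ (X, 0, 0)` is left adjoint to the projection to `𝒜`. -/
def commaZeroAdj : commaZero T ⊣ Comma.snd T (𝟭 𝒜) :=
  Adjunction.mkOfHomEquiv
    { homEquiv := fun X Z =>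
        { toFun := fun f => f.right
          invFun := fun g =>
            { left := 0
              right := g
              w := (T.map_isZero (isZero_zero ℬ)).eq_of_src _ _ }
          left_inv := fun f => by
            ext
            · exact (isZero_zero ℬ).eq_of_src _ _
            · rfl
          right_inv := fun g => rfl }
      homEquiv_naturality_left_symm := fun f g => by
        ext
        · exact (isZero_zero ℬ).eq_of_src _ _
        · rfl }

end CommaFunctors

end Paper

/-- under the hypotheses of Proposition 2.5,
`𝔅^𝒲_𝒱 ⊆ (𝔅^𝒳_𝒴)^⊥` in the comma category `(T ↓ 𝒜)`. -/
theorem statement5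
    {𝒜 : Type u} [Category.{v} 𝒜] [Abelian 𝒜] [EnoughProjectives 𝒜] [EnoughInjectives 𝒜]
    {ℬ : Type u'} [Category.{v'} ℬ] [Abelian ℬ] [EnoughProjectives ℬ] [EnoughInjectives ℬ]
    (T : ℬ ⥤ 𝒜) [T.Additive] [PreservesFiniteColimits T]
    [Abelian (Comma T (𝟭 𝒜))]
    [HasExt.{w₁} 𝒜] [HasExt.{w₂} ℬ] [HasExt.{w₃} (Comma T (𝟭 𝒜))]
    (𝒳 𝒲 : Set 𝒜) (𝒴 𝒱 : Set ℬ)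
    (hA : IsLeftFrobeniusPair 𝒳 𝒲) (hB : IsLeftFrobeniusPair 𝒴 𝒱)
    (hV : ∀ V ∈ 𝒱, T.obj V ∈ Hat 𝒲)
    (hLT : ∀ Y ∈ 𝒴, ∀ n : ℕ, 1 ≤ n → IsZero ((T.leftDerived n).obj Y))
    (Z : Comma T (𝟭 𝒜)) (hZ : Z ∈ CommaClass T 𝒳 𝒴)
    (W : Comma T (𝟭 𝒜)) (hW : W ∈ CommaClass T 𝒲 𝒱)
    (i : ℕ) (hi : 1 ≤ i) :
    Subsingleton (Abelian.Ext.{w₃} Z W i) := by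
  have := fun (J : Type) [SmallCategory J] [FinCategory J] =>
    preservesLimitsOfShape_comma_fst (𝒜 := 𝒜) T J
  have := fun (J : Type) [SmallCategory J] [FinCategory J] =>
    preservesLimitsOfShape_comma_snd (𝒜 := 𝒜) T J
  have : PreservesFiniteLimits (Comma.fst T (𝟭 𝒜)) := ⟨fun _ _ _ => inferInstance⟩
  have : PreservesFiniteLimits (Comma.snd T (𝟭 𝒜)) := ⟨fun _ _ _ => inferInstance⟩
  have : PreservesFiniteColimits (Comma.fst T (𝟭 𝒜)) := ⟨fun _ _ _ => inferInstance⟩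
  have : PreservesFiniteColimits (Comma.snd T (𝟭 𝒜)) := ⟨fun _ _ _ => inferInstance⟩
  obtain ⟨hZY, _, hZX⟩ := hZ
  obtain ⟨hWV, _, hWW⟩ := hW
  obtain ⟨X, hX, g, wg, hg⟩ := exists_shortExact_of_memIso_cokernel Z.hom hZX
  obtain ⟨W', hW', k, wk, hk⟩ := exists_shortExact_of_memIso_cokernel W.hom hWW
  let f : (commaFree T).obj Z.left ⟶ Z :=
    { left := 𝟙 Z.left
      right := Z.hom
      w := congrArg (· ≫ Z.hom) (T.map_id Z.left) }
  let g' : Z ⟶ (commaZero T).obj X :=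
    { left := 0
      right := g
      w := (comp_zero).trans wg.symm }
  have hp : (ShortComplex.mk (𝟙 Z.left) (0 : Z.left ⟶ 0) comp_zero).ShortExact :=
    .mk' ((ShortComplex.exact_iff_epi _ rfl).2 inferInstance) inferInstance
      ⟨fun _ _ _ => (isZero_zero ℬ).eq_of_src _ _⟩
  refine subsingleton_ext_of_gluing (p := Comma.fst T (𝟭 𝒜)) (q := Comma.snd T (𝟭 𝒜))
    (fun a b h h' => CommaMorphism.ext h h') T (commaZeroAdj T) (Iso.refl _)
    (fun _ => isZero_zero ℬ) (commaFreeAdj T) (Iso.refl _) (Iso.refl _) f g'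
    comp_zero hp wg hg (fun i hi => ?_) (fun i hi => hB.W_subset_rightPerp _ hWV _ hZY i hi)
    (hLT _ hZY) i hi
  have : Subsingleton (Abelian.Ext.{w₁} X W' i) := hA.W_subset_rightPerp _ hW' _ hX i hi
  have : Subsingleton (Abelian.Ext.{w₁} X (T.obj W.left) i) :=
    subsingleton_ext_hat (fun V hV => hA.W_subset_rightPerp _ hV _ hX) (hV _ hWV) i hi
  exact subsingleton_ext_of_shortExact_right hk X i
end
end

section
/- Let 𝒜 and ℬ be abelian categories with enough projectives and injectives, T : ℬ → 𝒜 a right exact functor, (𝒳,𝒲) a left Frobenius pair in 𝒜 and (𝒴,𝒱) a left Frobenius pair in ℬ, with T(V) ∈ 𝒲̂ for every V ∈ 𝒱 and (L_nT)(Y) = 0 for every Y ∈ 𝒴 and every n ≥ 1. Then for every object (X,Y,φ) ∈ 𝔅^𝒳_𝒴 there exists a short exact sequence 0 → (X,Y,φ) → M → N → 0 in the comma category (T↓𝒜) with M ∈ 𝔅^𝒲_𝒱 and N ∈ 𝔅^𝒳_𝒴; that is, 𝔅^𝒲_𝒱 is a cogenerator for 𝔅^𝒳_𝒴. -/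
/-!
Formalization of a statement from "Recollements induced by left Frobenius pairs"
(Ma, Sun, Zhu, Hu). Auxiliary definitions (left Frobenius pairs, the classes
`𝒳̂` and `𝔅^𝒳_𝒴`, etc.) are given first; the statement itself is the final theorem.
-/

noncomputable section
open CategoryTheory CategoryTheory.Limits ZeroObject Paper

universe w₁ w₂ w₃ v v' u u'

namespace Paper

section Ext

variable {𝒜 : Type u} [Category.{v} 𝒜] [Abelian 𝒜] [HasExt.{w₁} 𝒜] {𝒳 𝒲 : Set 𝒜}

lemma IsLeftFrobeniusPair.mem_of_memIso (h : IsLeftFrobeniusPair 𝒳 𝒲) {C : 𝒜}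
    (hC : MemIso 𝒳 C) : C ∈ 𝒳 := by
  obtain ⟨X, hX, ⟨e⟩⟩ := hC
  exact h.closed_summands_X X C 0 hX ⟨e ≪≫ (isoBiprodZero (isZero_zero 𝒜))⟩

lemma subsingleton_ext_of_hasResolutionOfLength (X : 𝒜)
    (h : ∀ W ∈ 𝒲, ∀ i : ℕ, 1 ≤ i → Subsingleton (Abelian.Ext X W i)) (n : ℕ) (C : 𝒜)
    (hC : HasResolutionOfLength 𝒲 n C) (i : ℕ) (hi : 1 ≤ i) :
    Subsingleton (Abelian.Ext X C i) := by
  induction n generalizing C i with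
  | zero =>
    obtain ⟨W, hW, ⟨e⟩⟩ := hC
    have := h W hW i hi
    refine subsingleton_of_forall_eq 0 fun x ↦ ?_
    have hx : (x.comp (Abelian.Ext.mk₀ e.inv) (add_zero i)).comp
        (Abelian.Ext.mk₀ e.hom) (add_zero i) = x := by
      rw [Abelian.Ext.comp_assoc_of_third_deg_zero, Abelian.Ext.mk₀_comp_mk₀, e.inv_hom_id,
        Abelian.Ext.comp_mk₀_id]
    rw [← hx, Subsingleton.elim (x.comp (Abelian.Ext.mk₀ e.inv) (add_zero i)) 0,
      Abelian.Ext.zero_comp]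
  | succ n ih =>
    obtain ⟨S, hS, rfl, h₂, h₁⟩ := hC
    have := h _ h₂ i hi
    have := ih _ h₁ (i + 1) (by omega)
    refine subsingleton_of_forall_eq 0 fun x ↦ ?_
    obtain ⟨y, rfl⟩ := Abelian.Ext.covariant_sequence_exact₃ X hS x rfl (Subsingleton.elim _ _)
    rw [Subsingleton.elim y 0, Abelian.Ext.zero_comp]

lemma exists_extension_of_subsingleton_ext {S : ShortComplex 𝒜} (hS : S.ShortExact) (Y : 𝒜)
    [Subsingleton (Abelian.Ext S.X₃ Y 1)] (f : S.X₁ ⟶ Y) : ∃ g : S.X₂ ⟶ Y, S.f ≫ g = f := by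
  obtain ⟨x, hx⟩ := Abelian.Ext.contravariant_sequence_exact₁ hS Y (Abelian.Ext.mk₀ f) rfl
    (Subsingleton.elim _ _)
  obtain ⟨g, rfl⟩ := (Abelian.Ext.mk₀_bijective _ _).2 x
  refine ⟨g, (Abelian.Ext.mk₀_bijective _ _).1 ?_⟩
  rw [← hx, Abelian.Ext.mk₀_comp_mk₀]

end Ext

section LeftDerived

variable {𝒜 : Type u} [Category.{v} 𝒜] [Abelian 𝒜]
  {ℬ : Type u'} [Category.{v'} ℬ] [Abelian ℬ] [EnoughProjectives ℬ]

lemma exact_map_resolution_of_isZero_leftDerived_one (T : ℬ ⥤ 𝒜) [T.Additive] {Y : ℬ}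
    (P : ProjectiveResolution Y) (hY : IsZero ((T.leftDerived 1).obj Y)) {A : 𝒜}
    (x : A ⟶ T.obj (P.complex.X 1)) (hx : x ≫ T.map (P.complex.d 1 0) = 0) :
    ∃ (A' : 𝒜) (π : A' ⟶ A) (_ : Epi π) (y : A' ⟶ T.obj (P.complex.X 2)),
      π ≫ x = y ≫ T.map (P.complex.d 2 1) := by
  have h : ((T.mapHomologicalComplex _).obj P.complex).ExactAt 1 := by
    rw [HomologicalComplex.exactAt_iff_isZero_homology]
    exact hY.of_iso (P.isoLeftDerivedObj T 1).symm
  rw [HomologicalComplex.exactAt_iff_exact_up_to_refinements _ 2 1 0 (by simp) (by simp)] at h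
  exact h x hx

lemma mono_map_f_of_isZero_leftDerived_one (T : ℬ ⥤ 𝒜) [T.Additive]
    [PreservesFiniteColimits T] {S : ShortComplex ℬ} (hS : S.ShortExact)
    (h : IsZero ((T.leftDerived 1).obj S.X₃)) : Mono (T.map S.f) := by
  have := hS.mono_f
  have := hS.epi_g
  let P := projectiveResolution S.X₃
  let p : P.complex.X 0 ⟶ S.X₃ := P.π.f 0
  have hdp : P.complex.d 1 0 ≫ p = 0 := P.complex_d_comp_π_f_zero
  let b : P.complex.X 0 ⟶ S.X₂ := Projective.factorThru p S.g
  have hb : b ≫ S.g = p := Projective.factorThru_comp _ _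
  obtain ⟨a, ha⟩ : ∃ a, a ≫ S.f = P.complex.d 1 0 ≫ b :=
    ⟨_, hS.exact.lift_f (P.complex.d 1 0 ≫ b) (by rw [Category.assoc, hb, hdp])⟩
  let R : ShortComplex ℬ := ShortComplex.mk (biprod.lift (-a) (P.complex.d 1 0))
    (biprod.desc S.f b) (by simp [biprod.lift_desc, ha])
  have hR : R.Exact := by
    rw [ShortComplex.exact_iff_exact_up_to_refinements]
    intro A x hx
    have hx' : x ≫ biprod.fst ≫ S.f + x ≫ biprod.snd ≫ b = 0 := by
      rw [← Preadditive.comp_add, ← biprod.desc_eq]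
      exact hx
    have hxp : (x ≫ biprod.snd) ≫ p = 0 := by
      have := hx' =≫ S.g
      simpa [hb] using this
    obtain ⟨A', π, hπ, q, hq⟩ := P.exact₀.exact_up_to_refinements _ hxp
    refine ⟨A', π, hπ, q, biprod.hom_ext _ _ ?_ ?_⟩
    · rw [← cancel_mono S.f]
      have h₁ := π ≫= hx'
      have h₂ := hq =≫ b
      dsimp at h₂
      simp only [Category.assoc] at h₂
      rw [Preadditive.comp_add, h₂, ← ha, comp_zero] at h₁
      simpa [R] using eq_neg_of_add_eq_zero_left h₁
    · simpa [R] using hq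
  have hRg : Epi R.g := by
    rw [epi_iff_surjective_up_to_refinements]
    intro A v
    have : Epi p := inferInstanceAs (Epi (P.π.f 0))
    obtain ⟨A', π, hπ, x, hx⟩ := surjective_up_to_refinements_of_epi p (v ≫ S.g)
    refine ⟨A', π, hπ, biprod.lift (hS.exact.lift (π ≫ v - x ≫ b) ?_) x, ?_⟩
    · rw [Preadditive.sub_comp, Category.assoc, hx, Category.assoc, hb, sub_self]
    · simp [R, biprod.lift_desc]
  have hTR := hR.map_of_epi_of_preservesCokernel T hRg inferInstance
  rw [Preadditive.mono_iff_cancel_zero]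
  intro A y hy
  obtain ⟨A₁, π₁, _, q, hq⟩ : ∃ (A₁ : 𝒜) (π₁ : A₁ ⟶ A) (_ : Epi π₁)
      (q : A₁ ⟶ T.obj (P.complex.X 1)),
      π₁ ≫ y ≫ T.map biprod.inl = q ≫ T.map (biprod.lift (-a) (P.complex.d 1 0)) := by
    refine hTR.exact_up_to_refinements (y ≫ T.map biprod.inl) ?_
    have hf : T.map biprod.inl ≫ T.map (biprod.desc S.f b) = T.map S.f := by
      rw [← T.map_comp, biprod.inl_desc]
    exact (Category.assoc _ _ _).trans ((congrArg (y ≫ ·) hf).trans hy)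
  have hq₁ : π₁ ≫ y = q ≫ T.map (-a) := by
    have := hq =≫ T.map biprod.fst
    simpa only [Category.assoc, ← T.map_comp, biprod.inl_fst, biprod.inl_snd, biprod.lift_fst,
      biprod.lift_snd, T.map_id, T.map_zero, Category.comp_id, comp_zero] using this
  have hq₂ : q ≫ T.map (P.complex.d 1 0) = 0 := by
    have := hq =≫ T.map biprod.snd
    simpa only [Category.assoc, ← T.map_comp, biprod.inl_fst, biprod.inl_snd, biprod.lift_fst,
      biprod.lift_snd, T.map_id, T.map_zero, Category.comp_id, comp_zero] using this.symm
  obtain ⟨A₂, π₂, _, r, hr⟩ := exact_map_resolution_of_isZero_leftDerived_one T P h q hq₂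
  have hda : P.complex.d 2 1 ≫ a = 0 := by
    rw [← cancel_mono S.f, Category.assoc, ha, HomologicalComplex.d_comp_d_assoc, zero_comp,
      zero_comp]
  rw [← cancel_epi π₁, ← cancel_epi π₂, hq₁, reassoc_of% hr, ← T.map_comp, Preadditive.comp_neg,
    hda]
  simp

end LeftDerived

section Snake

variable {𝒜 : Type u} [Category.{v} 𝒜] [Abelian 𝒜]

lemma mono_lift_of_mono {A C X V W : 𝒜} {φ : A ⟶ X} {π : X ⟶ C} (w : φ ≫ π = 0)
    (hX : (ShortComplex.mk φ π w).Exact) (f : A ⟶ V) [Mono f] (ι : C ⟶ W) [Mono ι]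
    (g : X ⟶ V) (hg : φ ≫ g = f) : Mono (biprod.lift g (π ≫ ι)) := by
  rw [Preadditive.mono_iff_cancel_zero]
  intro D x hx
  have hx₁ : x ≫ g = 0 := by simpa using hx =≫ biprod.fst
  have hx₂ : x ≫ π = 0 := by
    rw [← cancel_mono ι]
    simpa using hx =≫ biprod.snd
  obtain ⟨D', p, _, y, hy⟩ := hX.exact_up_to_refinements x hx₂
  dsimp at hy
  have : y = 0 := by
    rw [← cancel_mono f, ← hg, ← reassoc_of% hy, hx₁, comp_zero, zero_comp]
  rw [← cancel_epi p, hy, this, zero_comp, comp_zero]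

variable {A B C C' X V W : 𝒜} {φ : A ⟶ X} {π : X ⟶ C} {w : φ ≫ π = 0}
  {f : A ⟶ V} {p : V ⟶ B} {ι : C ⟶ W} {q : W ⟶ C'} {wι : ι ≫ q = 0}
  {g : X ⟶ V} {n : B ⟶ cokernel (biprod.lift g (π ≫ ι))}

lemma mono_of_comp_eq_inl_comp_cokernel_π (hX : (ShortComplex.mk φ π w).Exact) [Epi p] [Mono ι]
    (wf : f ≫ p = 0) (hg : φ ≫ g = f)
    (hn : p ≫ n = biprod.inl ≫ cokernel.π (biprod.lift g (π ≫ ι))) : Mono n := by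
  rw [Preadditive.mono_iff_cancel_zero]
  intro D t ht
  obtain ⟨D₁, p₁, _, s, hs⟩ := surjective_up_to_refinements_of_epi p t
  obtain ⟨D₂, p₂, _, x, hx⟩ :=
    (ShortComplex.exact_cokernel (biprod.lift g (π ≫ ι))).exact_up_to_refinements
      (s ≫ biprod.inl) (by
        dsimp
        rw [Category.assoc, ← hn, ← reassoc_of% hs, ht, comp_zero])
  dsimp at hx
  have hx₁ : p₂ ≫ s = x ≫ g := by simpa using hx =≫ biprod.fst
  have hx₂ : x ≫ π = 0 := by
    rw [← cancel_mono ι]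
    simpa using (hx =≫ biprod.snd).symm
  obtain ⟨D₃, p₃, _, y, hy⟩ := hX.exact_up_to_refinements x hx₂
  dsimp at hy
  rw [← cancel_epi p₁, ← cancel_epi p₂, ← cancel_epi p₃, hs, reassoc_of% hx₁, reassoc_of% hy,
    reassoc_of% hg, wf]
  simp

lemma nonempty_iso_cokernel_of_comp_eq_inl_comp_cokernel_π [Epi π] [Epi p]
    (hW : (ShortComplex.mk ι q wι).Exact) [Epi q]
    (hn : p ≫ n = biprod.inl ≫ cokernel.π (biprod.lift g (π ≫ ι))) :
    Nonempty (C' ≅ cokernel n) := by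
  let c : cokernel (biprod.lift g (π ≫ ι)) ⟶ C' :=
    cokernel.desc _ (biprod.snd ≫ q) (by simp [wι])
  have hc : cokernel.π _ ≫ c = biprod.snd ≫ q := cokernel.π_desc _ _ _
  have hnc : n ≫ c = 0 := by
    rw [← cancel_epi p, reassoc_of% hn, hc]
    simp
  have : Epi c := epi_of_epi_fac hc
  have hlim : IsColimit (CokernelCofork.ofπ c hnc) := by
    refine CokernelCofork.IsColimit.ofπ' c hnc fun {D} k hk ↦ ?_
    have h₁ : biprod.inl ≫ cokernel.π (biprod.lift g (π ≫ ι)) ≫ k = 0 := by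
      rw [← reassoc_of% hn, hk, comp_zero]
    have h₂ : ι ≫ biprod.inr ≫ cokernel.π (biprod.lift g (π ≫ ι)) ≫ k = 0 := by
      rw [← cancel_epi π]
      have h₃ : (g ≫ biprod.inl + (π ≫ ι) ≫ biprod.inr) ≫
          cokernel.π (biprod.lift g (π ≫ ι)) ≫ k = 0 := by
        rw [← biprod.lift_eq, cokernel.condition_assoc, zero_comp]
      simpa [h₁] using h₃
    refine ⟨hW.desc (biprod.inr ≫ cokernel.π (biprod.lift g (π ≫ ι)) ≫ k) h₂, ?_⟩
    rw [← cancel_epi (cokernel.π _), reassoc_of% hc]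
    have h₄ := hW.g_desc _ h₂
    dsimp at h₄
    rw [h₄]
    refine biprod.hom_ext' _ _ ?_ ?_
    · simp [h₁]
    · simp
  exact ⟨hlim.coconePointUniqueUpToIso (colimit.isColimit _)⟩

end Snake

section CommaLemmas

variable {𝒜 : Type u} [Category.{v} 𝒜] [Abelian 𝒜]
  {ℬ : Type u'} [Category.{v'} ℬ] [Abelian ℬ] {T : ℬ ⥤ 𝒜} [T.Additive]

lemma categoryWithHomology_of_hasZeroMorphisms (C : Type u) [Category.{v} C] [Abelian C]
    (h : HasZeroMorphisms C) : CategoryWithHomology C := by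
  obtain rfl : h = Preadditive.preadditiveHasZeroMorphisms := Subsingleton.elim _ _
  infer_instance

lemma comma_shortExact [Abelian (Comma T (𝟭 𝒜))] {Z₁ Z₂ Z₃ : Comma T (𝟭 𝒜)}
    (f : Z₁ ⟶ Z₂) (g : Z₂ ⟶ Z₃) (wl : f.left ≫ g.left = 0) (wr : f.right ≫ g.right = 0)
    (hl : (ShortComplex.mk _ _ wl).ShortExact) (hr : (ShortComplex.mk _ _ wr).ShortExact) :
    ∃ w : f ≫ g = 0, (ShortComplex.mk f g w).ShortExact := by
  have := categoryWithHomology_of_hasZeroMorphisms (Comma T (𝟭 𝒜)) inferInstance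
  have hfl : Mono f.left := hl.mono_f
  have hfr : Mono f.right := hr.mono_f
  have hgl : Epi g.left := hl.epi_g
  have hgr : Epi g.right := hr.epi_g
  have w : f ≫ g = 0 := by
    ext
    · exact wl
    · exact wr
  have : Mono f := ⟨fun a b hab ↦ by
    ext
    · exact (cancel_mono f.left).1 (congrArg CommaMorphism.left hab)
    · exact (cancel_mono f.right).1 (congrArg CommaMorphism.right hab)⟩
  have : Epi g := ⟨fun a b hab ↦ by
    ext
    · exact (cancel_epi g.left).1 (congrArg CommaMorphism.left hab)
    · exact (cancel_epi g.right).1 (congrArg CommaMorphism.right hab)⟩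
  refine ⟨w, { exact := ShortComplex.exact_of_f_is_kernel (ShortComplex.mk f g w) ?_, mono_f := ‹_›, epi_g := ‹_› }⟩
  refine KernelFork.IsLimit.ofι' f w fun {D} k hk ↦ ?_
  have kl : k.left ≫ g.left = 0 := by
    rw [← Comma.comp_left, hk]
    rfl
  have kr : k.right ≫ g.right = 0 := by
    rw [← Comma.comp_right, hk]
    rfl
  have el : hl.exact.lift k.left kl ≫ f.left = k.left := hl.exact.lift_f _ _
  have er : hr.exact.lift k.right kr ≫ f.right = k.right := hr.exact.lift_f _ _
  refine ⟨{ left := hl.exact.lift k.left kl, right := hr.exact.lift k.right kr, w := ?_ }, ?_⟩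
  · have hkw := k.w
    have hfw := f.w
    dsimp at hkw hfw ⊢
    rw [← cancel_mono f.right, Category.assoc, Category.assoc, er, ← hkw, ← hfw,
      ← T.map_comp_assoc, el]
  · ext
    · exact el
    · exact er

end CommaLemmas

end Paper

/-- under the hypotheses of Proposition 2.5, `𝔅^𝒲_𝒱` is a cogenerator
for `𝔅^𝒳_𝒴`: every `Z ∈ 𝔅^𝒳_𝒴` admits a short exact sequence `0 → Z → M → N → 0`
with `M ∈ 𝔅^𝒲_𝒱` and `N ∈ 𝔅^𝒳_𝒴`. -/
theorem statement6
    {𝒜 : Type u} [Category.{v} 𝒜] [Abelian 𝒜] [EnoughProjectives 𝒜] [EnoughInjectives 𝒜]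
    {ℬ : Type u'} [Category.{v'} ℬ] [Abelian ℬ] [EnoughProjectives ℬ] [EnoughInjectives ℬ]
    (T : ℬ ⥤ 𝒜) [T.Additive] [PreservesFiniteColimits T]
    [Abelian (Comma T (𝟭 𝒜))]
    [HasExt.{w₁} 𝒜] [HasExt.{w₂} ℬ]
    (𝒳 𝒲 : Set 𝒜) (𝒴 𝒱 : Set ℬ)
    (hA : IsLeftFrobeniusPair 𝒳 𝒲) (hB : IsLeftFrobeniusPair 𝒴 𝒱)
    (hV : ∀ V ∈ 𝒱, T.obj V ∈ Hat 𝒲)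
    (hLT : ∀ Y ∈ 𝒴, ∀ n : ℕ, 1 ≤ n → IsZero ((T.leftDerived n).obj Y))
    (Z : Comma T (𝟭 𝒜)) (hZ : Z ∈ CommaClass T 𝒳 𝒴) :
    ∃ S : ShortComplex (Comma T (𝟭 𝒜)), S.ShortExact ∧ S.X₁ = Z ∧
      S.X₂ ∈ CommaClass T 𝒲 𝒱 ∧ S.X₃ ∈ CommaClass T 𝒳 𝒴 := by
  obtain ⟨hY, hφ, hC⟩ := hZ
  have hC := hA.mem_of_memIso hC
  obtain ⟨SB, hSB, hSB₁, hSB₂, hSB₃⟩ := hB.cogenerator _ hY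
  obtain ⟨SA, hSA, hSA₁, hSA₂, hSA₃⟩ := hA.cogenerator _ hC
  obtain ⟨Y, X, φ⟩ := Z
  obtain @⟨Y₁, V, Y', f, p, wf⟩ := SB
  obtain @⟨C₁, W, C', ι, q, wι⟩ := SA
  dsimp at X φ hY hφ hC hSB₁ hSB₂ hSB₃ hSA₁ hSA₂ hSA₃
  subst hSB₁ hSA₁
  have hφ' : Mono φ := hφ
  have hι : Mono ι := hSA.mono_f
  have hq : Epi q := hSA.epi_g
  have hp : Epi p := hSB.epi_g
  have hTf : Mono (T.map f) := mono_map_f_of_isZero_leftDerived_one T hSB (hLT _ hSB₃ 1 le_rfl)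
  have hTp : Epi (T.map p) := inferInstance
  have wT : T.map f ≫ T.map p = 0 := by rw [← T.map_comp, wf, T.map_zero]
  have hTe : (ShortComplex.mk (T.map f) (T.map p) wT).Exact :=
    hSB.exact.map_of_epi_of_preservesCokernel T hp inferInstance
  have hX := ShortComplex.exact_cokernel φ
  have hXs : (ShortComplex.mk φ (cokernel.π φ) (cokernel.condition φ)).ShortExact :=
    { exact := hX, mono_f := hφ', epi_g := inferInstance }
  obtain ⟨m, hm⟩ := hV V hSB₂
  have : Subsingleton (Abelian.Ext (cokernel φ) (T.obj V) 1) :=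
    subsingleton_ext_of_hasResolutionOfLength _
      (fun W hW i hi ↦ hA.W_subset_rightPerp W hW _ hC i hi) m _ hm 1 le_rfl
  obtain ⟨g, hg⟩ := exists_extension_of_subsingleton_ext hXs (T.obj V) (T.map f)
  dsimp at g hg
  let j : X ⟶ T.obj V ⊞ W := biprod.lift g (cokernel.π φ ≫ ι)
  have hφj : φ ≫ j = T.map f ≫ biprod.inl := by
    refine biprod.hom_ext _ _ ?_ ?_
    · simp [j, hg]
    · simp [j]
  have hj : Mono j := mono_lift_of_mono (cokernel.condition φ) hX (T.map f) ι g hg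
  obtain ⟨n, hn⟩ : ∃ n : T.obj Y' ⟶ cokernel j, T.map p ≫ n = biprod.inl ≫ cokernel.π j :=
    ⟨_, hTe.g_desc (biprod.inl ≫ cokernel.π j) (by
      rw [← reassoc_of% hφj, cokernel.condition, comp_zero])⟩
  have hnm : Mono n := mono_of_comp_eq_inl_comp_cokernel_π hX wT hg hn
  have hnc : Nonempty (C' ≅ cokernel n) :=
    nonempty_iso_cokernel_of_comp_eq_inl_comp_cokernel_π hSA.exact hn
  let M : Comma T (𝟭 𝒜) := { left := V, right := T.obj V ⊞ W, hom := biprod.inl }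
  let N : Comma T (𝟭 𝒜) := { left := Y', right := cokernel j, hom := n }
  let F : Comma.mk Y₁ X φ ⟶ M := { left := f, right := j, w := hφj.symm }
  let G : M ⟶ N := { left := p, right := cokernel.π j, w := hn }
  obtain ⟨w, hw⟩ := comma_shortExact F G wf (cokernel.condition j) hSB
    { exact := ShortComplex.exact_cokernel j, mono_f := hj, epi_g := inferInstance }
  refine ⟨_, hw, rfl, ⟨hSB₂, inferInstanceAs (Mono (biprod.inl : T.obj V ⟶ T.obj V ⊞ W)), W, hSA₂,
    ⟨?_⟩⟩, ⟨hSB₃, hnm, C', hSA₃, hnc⟩⟩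
  exact (biprod.isCokernelInlCokernelFork (T.obj V) W).coconePointUniqueUpToIso
    (colimit.isColimit _)
end
end

section
/- Let 𝒜 be an abelian category with enough projectives and injectives and (𝒳,𝒲) a left Frobenius pair in 𝒜. Let f : X₁ → X₂ be a morphism with X₁, X₂ ∈ 𝒳 such that for every W ∈ 𝒲 the induced map Hom_𝒜(X₂, W) → Hom_𝒜(X₁, W), g ↦ g∘f, is surjective. Then f is a monomorphism and Coker f ∈ 𝒳. -/
/-!
Formalization of a statement from "Recollements induced by left Frobenius pairs"
(Ma, Sun, Zhu, Hu). Auxiliary definitions (left Frobenius pairs, the classes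
`𝒳̂` and `𝔅^𝒳_𝒴`, etc.) are given first; the statement itself is the final theorem.
-/

noncomputable section
open CategoryTheory CategoryTheory.Limits ZeroObject Paper

universe w₁ w₂ w₃ v v' u u'

/-- from the proof of Lemma 3.4: if `(𝒳,𝒲)` is a left Frobenius pair,
`f : X₁ ⟶ X₂` is a morphism between objects of `𝒳` such that `Hom(f, W)` is surjective
for every `W ∈ 𝒲`, then `f` is a monomorphism and `Coker f ∈ 𝒳`. -/
theorem statement8
    {𝒜 : Type u} [Category.{v} 𝒜] [Abelian 𝒜] [EnoughProjectives 𝒜] [EnoughInjectives 𝒜]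
    [HasExt.{w₁} 𝒜]
    (𝒳 𝒲 : Set 𝒜) (h : IsLeftFrobeniusPair 𝒳 𝒲)
    {X₁ X₂ : 𝒜} (hX₁ : X₁ ∈ 𝒳) (hX₂ : X₂ ∈ 𝒳) (f : X₁ ⟶ X₂)
    (hsurj : ∀ W ∈ 𝒲, Function.Surjective (fun g : X₂ ⟶ W => f ≫ g)) :
    Mono f ∧ cokernel f ∈ 𝒳 := by
  obtain ⟨S, hS, hS₁, hS₂, hS₃⟩ := h.cogenerator X₁ hX₁
  obtain @⟨X₁', W, X', i, q, w⟩ := S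
  dsimp at hS₁ hS₂ hS₃
  subst hS₁
  obtain ⟨g, hg⟩ := hsurj W hS₂ i
  dsimp at hg
  have hi : Mono i := hS.mono_f
  have hq : Epi q := hS.epi_g
  have hf : Mono f := by
    rw [← hg] at hi
    exact mono_of_mono f g
  refine ⟨hf, ?_⟩
  let π := cokernel.π f
  have hfπ : f ≫ π = 0 := cokernel.condition f
  have hfE : (ShortComplex.mk f π hfπ).Exact :=
    ShortComplex.exact_of_g_is_cokernel _ (cokernelIsCokernel f)
  -- The pushout of `i` and `f` is `cokernel f ⊞ W`, since `g` splits off `W`.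
  let d : cokernel f ⟶ X' := cokernel.desc f (-(g ≫ q)) (by
    rw [Preadditive.comp_neg, ← Category.assoc, hg, w, neg_zero])
  have hd : π ≫ d = -(g ≫ q) := cokernel.π_desc _ _ _
  let T : ShortComplex 𝒜 := ShortComplex.mk (biprod.lift π g) (biprod.desc d q) (by
    rw [biprod.lift_desc, hd, neg_add_cancel])
  have hT : T.ShortExact :=
    { exact := by
        rw [ShortComplex.exact_iff_exact_up_to_refinements]
        intro A (z : A ⟶ cokernel f ⊞ W) (hz : z ≫ biprod.desc d q = 0)
        obtain ⟨A', p, hp, x, hx⟩ :=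
          surjective_up_to_refinements_of_epi π (z ≫ biprod.fst)
        have hz' : (z ≫ biprod.fst) ≫ d + (z ≫ biprod.snd) ≫ q = 0 := by
          rw [← hz, biprod.desc_eq, Preadditive.comp_add, Category.assoc, Category.assoc]
        have hy : (p ≫ z ≫ biprod.snd - x ≫ g) ≫ q = 0 := by
          have h₁ : p ≫ (z ≫ biprod.fst) ≫ d = -(x ≫ g ≫ q) := by
            rw [← Category.assoc, hx, Category.assoc, hd, Preadditive.comp_neg]
          have h₂ := congrArg (p ≫ ·) hz'
          simp only [Preadditive.comp_add, comp_zero, h₁] at h₂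
          rw [Preadditive.sub_comp, sub_eq_add_neg, add_comm]
          simpa only [Category.assoc] using h₂
        let y := hS.exact.lift _ hy
        have hyi : y ≫ i = p ≫ z ≫ biprod.snd - x ≫ g := hS.exact.lift_f _ hy
        refine ⟨A', p, hp, x + y ≫ f, ?_⟩
        change p ≫ z = (x + y ≫ f) ≫ biprod.lift π g
        ext
        · simp only [Category.assoc, biprod.lift_fst, Preadditive.add_comp, hfπ, comp_zero,
            add_zero, hx]
        · simp only [Category.assoc, biprod.lift_snd, Preadditive.add_comp, hg, hyi,
            add_sub_cancel]
      mono_f := by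
        refine Preadditive.mono_of_cancel_zero _ fun {A} (x : A ⟶ X₂)
          (hx : x ≫ biprod.lift π g = 0) => ?_
        have hxπ : x ≫ π = 0 := by
          simpa only [Category.assoc, biprod.lift_fst, zero_comp] using
            congrArg (· ≫ biprod.fst) hx
        have hxg : x ≫ g = 0 := by
          simpa only [Category.assoc, biprod.lift_snd, zero_comp] using
            congrArg (· ≫ biprod.snd) hx
        have hy : hfE.lift x hxπ ≫ f = x := hfE.lift_f x hxπ
        have hy₀ : hfE.lift x hxπ = 0 := by
          rw [← cancel_mono i, ← hg, ← Category.assoc, hy, hxg, zero_comp]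
        rw [← hy, hy₀, zero_comp]
      epi_g := by
        have : Epi (biprod.inr ≫ biprod.desc d q) := by rwa [biprod.inr_desc]
        exact epi_of_epi biprod.inr (biprod.desc d q) }
  exact h.closed_summands_X _ (cokernel f) W (h.closed_extensions T hT hX₂ hS₃) ⟨Iso.refl _⟩
end
end

section
/- Let 𝒜 be an abelian category with enough projectives and injectives and let (𝒳,𝒴) be a complete hereditary cotorsion pair in 𝒜. Then (𝒳, 𝒳 ∩ 𝒴) is a left Frobenius pair in 𝒜. -/
/-!
Formalization of a statement from "Recollements induced by left Frobenius pairs"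
(Ma, Sun, Zhu, Hu). Auxiliary definitions (left Frobenius pairs, the classes
`𝒳̂` and `𝔅^𝒳_𝒴`, etc.) are given first; the statement itself is the final theorem.
-/

noncomputable section
namespace Paper
open CategoryTheory CategoryTheory.Limits ZeroObject

universe w₁ w₂ w₃ v v' u u'

section Cotorsion
variable {𝒜 : Type u} [Category.{v} 𝒜] [Abelian 𝒜] [HasExt.{w₁} 𝒜]

/-- `(𝒳, 𝒴)` is a cotorsion pair: each class is the `Ext¹`-orthogonal of the other. -/
structure IsCotorsionPair (𝒳 𝒴 : Set 𝒜) : Prop where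
  mem_left_iff : ∀ A : 𝒜, A ∈ 𝒳 ↔ ∀ Y ∈ 𝒴, Subsingleton (Abelian.Ext A Y 1)
  mem_right_iff : ∀ A : 𝒜, A ∈ 𝒴 ↔ ∀ X ∈ 𝒳, Subsingleton (Abelian.Ext X A 1)

/-- A complete cotorsion pair. -/
structure IsCompleteCotorsionPair (𝒳 𝒴 : Set 𝒜) extends IsCotorsionPair 𝒳 𝒴 : Prop where
  deres : ∀ A : 𝒜, ∃ S : ShortComplex 𝒜, S.ShortExact ∧ S.X₁ ∈ 𝒴 ∧ S.X₂ ∈ 𝒳 ∧ S.X₃ = A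
  cores : ∀ A : 𝒜, ∃ S : ShortComplex 𝒜, S.ShortExact ∧ S.X₁ = A ∧ S.X₂ ∈ 𝒴 ∧ S.X₃ ∈ 𝒳

/-- A complete hereditary cotorsion pair. -/
structure IsCompleteHereditaryCotorsionPair (𝒳 𝒴 : Set 𝒜)
    extends IsCompleteCotorsionPair 𝒳 𝒴 : Prop where
  hereditary : ∀ X ∈ 𝒳, ∀ Y ∈ 𝒴, ∀ i : ℕ, 1 ≤ i → Subsingleton (Abelian.Ext X Y i)

/-- A projective cotorsion pair: a complete cotorsion pair `(𝒳, 𝒴)` such that `𝒴` is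
thick and `𝒳 ∩ 𝒴` is exactly the class of projective objects. -/
structure IsProjectiveCotorsionPair (𝒳 𝒴 : Set 𝒜)
    extends IsCompleteCotorsionPair 𝒳 𝒴 : Prop where
  thick_summands : ∀ C A B : 𝒜, C ∈ 𝒴 → Nonempty (C ≅ A ⊞ B) → A ∈ 𝒴
  thick_two_of_three₁ : ∀ S : ShortComplex 𝒜, S.ShortExact → S.X₂ ∈ 𝒴 → S.X₃ ∈ 𝒴 → S.X₁ ∈ 𝒴
  thick_two_of_three₂ : ∀ S : ShortComplex 𝒜, S.ShortExact → S.X₁ ∈ 𝒴 → S.X₃ ∈ 𝒴 → S.X₂ ∈ 𝒴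
  thick_two_of_three₃ : ∀ S : ShortComplex 𝒜, S.ShortExact → S.X₁ ∈ 𝒴 → S.X₂ ∈ 𝒴 → S.X₃ ∈ 𝒴
  inter_eq_projectives : ∀ C : 𝒜, (C ∈ 𝒳 ∧ C ∈ 𝒴) ↔ Projective C

end Cotorsion

end Paper

open CategoryTheory CategoryTheory.Limits ZeroObject Paper

universe w₁ w₂ w₃ v v' u u'

namespace CategoryTheory.Abelian.Ext

variable {𝒜 : Type u} [Category.{v} 𝒜] [Abelian 𝒜] [HasExt.{w₁} 𝒜]

lemma subsingleton_X₂_of_shortExact {S : ShortComplex 𝒜} (hS : S.ShortExact) (Y : 𝒜) (n : ℕ)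
    [Subsingleton (Ext S.X₁ Y n)] [Subsingleton (Ext S.X₃ Y n)] :
    Subsingleton (Ext S.X₂ Y n) := by
  refine subsingleton_of_forall_eq 0 fun x => ?_
  obtain ⟨y, rfl⟩ := contravariant_sequence_exact₂ hS Y x (Subsingleton.elim _ _)
  rw [Subsingleton.elim y 0, comp_zero]

lemma subsingleton_X₁_of_shortExact {S : ShortComplex 𝒜} (hS : S.ShortExact) (Y : 𝒜) {n m : ℕ}
    (hnm : 1 + n = m) [Subsingleton (Ext S.X₂ Y n)] [Subsingleton (Ext S.X₃ Y m)] :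
    Subsingleton (Ext S.X₁ Y n) := by
  refine subsingleton_of_forall_eq 0 fun x => ?_
  obtain ⟨y, rfl⟩ := contravariant_sequence_exact₁ hS Y x hnm (Subsingleton.elim _ _)
  rw [Subsingleton.elim y 0, comp_zero]

lemma subsingleton_of_retract_left {A C : 𝒜} (r : Retract A C) (Y : 𝒜) (n : ℕ)
    [Subsingleton (Ext C Y n)] : Subsingleton (Ext A Y n) := by
  refine subsingleton_of_forall_eq 0 fun x => ?_
  rw [← mk₀_id_comp x, ← r.retract, ← mk₀_comp_mk₀_assoc,
    Subsingleton.elim ((mk₀ r.r).comp x (zero_add n)) 0, comp_zero]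

lemma subsingleton_of_retract_right {A C : 𝒜} (r : Retract A C) (X : 𝒜) (n : ℕ)
    [Subsingleton (Ext X C n)] : Subsingleton (Ext X A n) := by
  refine subsingleton_of_forall_eq 0 fun x => ?_
  rw [← comp_mk₀_id x, ← r.retract, ← mk₀_comp_mk₀, ← comp_assoc_of_third_deg_zero,
    Subsingleton.elim (x.comp (mk₀ r.i) (add_zero n)) 0, zero_comp]

end CategoryTheory.Abelian.Ext

namespace Paper

variable {𝒜 : Type u} [Category.{v} 𝒜] [Abelian 𝒜]

/-- A direct summand is a retract. -/
def retractOfIsoBiprod {A B C : 𝒜} (e : C ≅ A ⊞ B) : Retract A C where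
  i := biprod.inl ≫ e.inv
  r := e.hom ≫ biprod.fst

variable [HasExt.{w₁} 𝒜] {𝒳 𝒴 : Set 𝒜}

namespace IsCotorsionPair

variable (h : IsCotorsionPair 𝒳 𝒴)
include h

lemma mem_left_of_retract {A C : 𝒜} (r : Retract A C) (hC : C ∈ 𝒳) : A ∈ 𝒳 :=
  (h.mem_left_iff A).2 fun Y hY =>
    have := (h.mem_left_iff C).1 hC Y hY
    Abelian.Ext.subsingleton_of_retract_left r Y 1

lemma mem_right_of_retract {A C : 𝒜} (r : Retract A C) (hC : C ∈ 𝒴) : A ∈ 𝒴 :=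
  (h.mem_right_iff A).2 fun X hX =>
    have := (h.mem_right_iff C).1 hC X hX
    Abelian.Ext.subsingleton_of_retract_right r X 1

lemma mem_left_of_extension {S : ShortComplex 𝒜} (hS : S.ShortExact) (h₁ : S.X₁ ∈ 𝒳)
    (h₃ : S.X₃ ∈ 𝒳) : S.X₂ ∈ 𝒳 :=
  (h.mem_left_iff _).2 fun Y hY =>
    have := (h.mem_left_iff _).1 h₁ Y hY
    have := (h.mem_left_iff _).1 h₃ Y hY
    Abelian.Ext.subsingleton_X₂_of_shortExact hS Y 1

end IsCotorsionPair

lemma IsCompleteHereditaryCotorsionPair.mem_left_of_kernel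
    (h : IsCompleteHereditaryCotorsionPair 𝒳 𝒴) {S : ShortComplex 𝒜} (hS : S.ShortExact)
    (h₂ : S.X₂ ∈ 𝒳) (h₃ : S.X₃ ∈ 𝒳) : S.X₁ ∈ 𝒳 :=
  (h.mem_left_iff _).2 fun Y hY =>
    have := h.hereditary _ h₂ Y hY 1 le_rfl
    have := h.hereditary _ h₃ Y hY 2 one_le_two
    Abelian.Ext.subsingleton_X₁_of_shortExact hS Y (n := 1) (m := 2) rfl

end Paper

/-- Lemma 4.1(1): if `(𝒳,𝒴)` is a complete hereditary cotorsion pair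
in `𝒜`, then `(𝒳, 𝒳 ∩ 𝒴)` is a left Frobenius pair in `𝒜`. -/
theorem statement9
    {𝒜 : Type u} [Category.{v} 𝒜] [Abelian 𝒜] [EnoughProjectives 𝒜] [EnoughInjectives 𝒜]
    [HasExt.{w₁} 𝒜]
    (𝒳 𝒴 : Set 𝒜) (h : IsCompleteHereditaryCotorsionPair 𝒳 𝒴) :
    IsLeftFrobeniusPair 𝒳 (𝒳 ∩ 𝒴) := by
  have hc := h.toIsCotorsionPair
  exact
    { closed_extensions := fun _ hS => hc.mem_left_of_extension hS
      closed_kernels_of_epis := fun _ hS => h.mem_left_of_kernel hS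
      closed_summands_X := fun _ _ _ hC ⟨e⟩ => hc.mem_left_of_retract (retractOfIsoBiprod e) hC
      closed_summands_W := fun _ _ _ hC ⟨e⟩ =>
        ⟨hc.mem_left_of_retract (retractOfIsoBiprod e) hC.1,
          hc.mem_right_of_retract (retractOfIsoBiprod e) hC.2⟩
      W_subset_X := Set.inter_subset_left
      W_subset_rightPerp := fun W hW X hX => h.hereditary X hX W hW.2
      cogenerator := by
        intro X hX
        obtain ⟨S, hS, rfl, h₂, h₃⟩ := h.cores X
        exact ⟨S, hS, rfl, ⟨hc.mem_left_of_extension hS hX h₃, h₂⟩, h₃⟩ }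
end
end
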